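/- Under Condition (A) (nQ₁(n) = o(Q₂(n))), let h*(n) be an integer-valued function satisfying (α₁A₂₁/(1-α₁)) h*(n) Q₁(h*(n)) ~ Q₂(n). Then for any λ₁, λ₂ > 0 and any integer-valued function h with 1 ≪ h(n) ≪ h*(n), setting m = n - h(n), one has lim_{n→∞} E[exp(-λ₁ (Q₁(h*(n))/Q₁(h(n))) Z₁(m,n) - λ₂ (Q₂(n)/Q₂₁(h(n))) Z₂(m,n)) | Z(n) ≠ 0, Z(0)=e₂] = 1 - (1 + (λ₁^{1-α₁} + λ₂)^{-α₂})^{-1/α₂}. -/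

import Mathlib

open MeasureTheory Filter Topology

/-- `a(n) ~ b(n)` : the ratio tends to `1` as `n → ∞`. -/
def Asymp (f g : ℕ → ℝ) : Prop :=
  Filter.Tendsto (fun n => f n / g n) Filter.atTop (nhds 1)

/-- A critical decomposable two-type Galton–Watson process together with its
reduced process.  `P1` is the law of the process started from one particle of
type 1 (`Z(0) = e₁`), `P2` the law started from one particle of type 2
(`Z(0) = e₂`).  `Z1 n`/`Z2 n` are the numbers of particles of types 1 and 2 at
time `n`; `R1 m n`/`R2 m n` are the numbers of particles of types 1 and 2 alive
at time `m` having descendants at time `n` (the reduced process). -/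
structure GWSetup where
  (Ω : Type)
  [mΩ : MeasurableSpace Ω]
  (P1 : Measure Ω)
  (P2 : Measure Ω)
  (hprob1 : IsProbabilityMeasure P1)
  (hprob2 : IsProbabilityMeasure P2)
  (Z1 : ℕ → Ω → ℕ)
  (Z2 : ℕ → Ω → ℕ)
  (R1 : ℕ → ℕ → Ω → ℕ)
  (R2 : ℕ → ℕ → Ω → ℕ)
  (mZ1 : ∀ n, Measurable (Z1 n))
  (mZ2 : ∀ n, Measurable (Z2 n))
  (mR1 : ∀ m n, Measurable (R1 m n))
  (mR2 : ∀ m n, Measurable (R2 m n))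
  (α1 : ℝ)
  (α2 : ℝ)
  (A21 : ℝ)
  (L1 : ℝ → ℝ)
  (L2 : ℝ → ℝ)
  (ρ : ℝ → ℝ → ℝ)
  (hα1 : 0 < α1 ∧ α1 ≤ 1)
  (hα2 : 0 < α2 ∧ α2 ≤ 1)
  (hA21 : 0 < A21)
  -- initial states
  (hinit1 : ∀ᵐ ω ∂P1, Z1 0 ω = 1 ∧ Z2 0 ω = 0)
  (hinit2 : ∀ᵐ ω ∂P2, Z1 0 ω = 0 ∧ Z2 0 ω = 1)
  -- type-1 particles produce only type-1 particles
  (hdecomp : ∀ n, ∀ᵐ ω ∂P1, Z2 n ω = 0)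
  -- criticality
  (hcrit1 : (∫ ω, (Z1 1 ω : ℝ) ∂P1) = 1)
  (hcrit2 : (∫ ω, (Z2 1 ω : ℝ) ∂P2) = 1)
  -- mean number of type-1 children of a type-2 particle
  (hmean21 : (∫ ω, (Z1 1 ω : ℝ) ∂P2) = A21)
  -- assumption (F1)
  (hF1 : ∀ s : ℝ, 0 ≤ s → s < 1 →
    (∫ ω, s ^ Z1 1 ω ∂P1) = s + (1 - s) ^ (1 + α1) * L1 (1 - s))
  -- assumption (F2)
  (hF2 : ∀ s1 s2 : ℝ, 0 ≤ s1 → s1 ≤ 1 → 0 ≤ s2 → s2 < 1 →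
    (∫ ω, s1 ^ Z1 1 ω * s2 ^ Z2 1 ω ∂P2) =
      s2 + (1 - s2) ^ (1 + α2) * L2 (1 - s2) - (A21 - ρ s1 s2) * (1 - s1))
  -- `L1`, `L2` are slowly varying at `0`
  (hL1 : ∀ c : ℝ, 0 < c →
    Filter.Tendsto (fun x => L1 (c * x) / L1 x) (nhdsWithin 0 (Set.Ioi 0)) (nhds 1))
  (hL2 : ∀ c : ℝ, 0 < c →
    Filter.Tendsto (fun x => L2 (c * x) / L2 x) (nhdsWithin 0 (Set.Ioi 0)) (nhds 1))
  -- `ρ(s₁,s₂) → 0` as `s₁ s₂ ↑ 1`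
  (hρ : ∀ ε : ℝ, 0 < ε → ∃ δ : ℝ, 0 < δ ∧ ∀ s1 s2 : ℝ,
    0 ≤ s1 → s1 ≤ 1 → 0 ≤ s2 → s2 ≤ 1 → 1 - δ < s1 * s2 → |ρ s1 s2| < ε)
  -- branching (semigroup) property at the level of generating functions
  (hbranch1 : ∀ m n : ℕ, ∀ s : ℝ, 0 ≤ s → s ≤ 1 →
    (∫ ω, s ^ Z1 (m + n) ω ∂P1) = ∫ ω, (∫ ω', s ^ Z1 n ω' ∂P1) ^ Z1 m ω ∂P1)
  (hbranch2 : ∀ m n : ℕ, ∀ s1 s2 : ℝ, 0 ≤ s1 → s1 ≤ 1 → 0 ≤ s2 → s2 ≤ 1 →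
    (∫ ω, s1 ^ Z1 (m + n) ω * s2 ^ Z2 (m + n) ω ∂P2) =
      ∫ ω, (∫ ω', s1 ^ Z1 n ω' ∂P1) ^ Z1 m ω *
        (∫ ω', s1 ^ Z1 n ω' * s2 ^ Z2 n ω' ∂P2) ^ Z2 m ω ∂P2)
  -- the reduced process vanishes on the extinction event
  (hext : ∀ m n : ℕ, ∀ᵐ ω ∂P2,
    (Z1 n ω = 0 ∧ Z2 n ω = 0) → (R1 m n ω = 0 ∧ R2 m n ω = 0))
  -- the generating function of the reduced process (conditioning on `Z(m)`)
  (hreduced : ∀ m n : ℕ, m ≤ n → ∀ s1 s2 : ℝ, 0 ≤ s1 → s1 ≤ 1 → 0 ≤ s2 → s2 ≤ 1 →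
    (∫ ω, s1 ^ R1 m n ω * s2 ^ R2 m n ω ∂P2) =
      ∫ ω, (1 - (1 - s1) * (P1 {ω' | Z1 (n - m) ω' ≠ 0}).toReal) ^ Z1 m ω *
        (1 - (1 - s2) *
          (P2 {ω' | Z1 (n - m) ω' ≠ 0 ∨ Z2 (n - m) ω' ≠ 0}).toReal) ^ Z2 m ω ∂P2)

namespace GWSetup

variable (S : GWSetup)

/-- The survival event `{Z(n) ≠ 0}` (under the law `P2`). -/
def surv (n : ℕ) : Set S.Ω := {ω | S.Z1 n ω ≠ 0 ∨ S.Z2 n ω ≠ 0}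

/-- `Q₁(n) = P(Z₁(n) > 0 | Z(0) = e₁)`. -/
noncomputable def Q1 (n : ℕ) : ℝ := (S.P1 {ω | S.Z1 n ω ≠ 0}).toReal

/-- `Q₂(n) = P(Z₂(n) > 0 | Z(0) = e₂)`. -/
noncomputable def Q2 (n : ℕ) : ℝ := (S.P2 {ω | S.Z2 n ω ≠ 0}).toReal

/-- `Q₂₁(n) = P(Z(n) ≠ 0 | Z(0) = e₂)`. -/
noncomputable def Q21 (n : ℕ) : ℝ := (S.P2 (S.surv n)).toReal

/-- `F₁(n; s) = E[s^{Z₁(n)} | Z(0) = e₁]`. -/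
noncomputable def F1 (n : ℕ) (s : ℝ) : ℝ := ∫ ω, s ^ S.Z1 n ω ∂S.P1

/-- `F₂₁(n; s₁, s₂) = E[s₁^{Z₁(n)} s₂^{Z₂(n)} | Z(0) = e₂]`. -/
noncomputable def F21 (n : ℕ) (s1 s2 : ℝ) : ℝ :=
  ∫ ω, s1 ^ S.Z1 n ω * s2 ^ S.Z2 n ω ∂S.P2

/-- `Q₁(n; s) = 1 - F₁(n; s)`. -/
noncomputable def Q1s (n : ℕ) (s : ℝ) : ℝ := 1 - S.F1 n s

/-- `Q₂(n; s) = 1 - E[s^{Z₂(n)} | Z(0) = e₂]`. -/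
noncomputable def Q2s (n : ℕ) (s : ℝ) : ℝ := 1 - S.F21 n 1 s

/-- `Q₂₁(n; s₁, s₂) = 1 - F₂₁(n; s₁, s₂)`. -/
noncomputable def Q21s (n : ℕ) (s1 s2 : ℝ) : ℝ := 1 - S.F21 n s1 s2

/-- The conditional expectation
`E[f(Z₁(m,n), Z₂(m,n)) | Z(n) ≠ 0, Z(0) = e₂]` for the reduced process. -/
noncomputable def Ered (m n : ℕ) (f : ℕ → ℕ → ℝ) : ℝ :=
  (∫ ω in S.surv n, f (S.R1 m n ω) (S.R2 m n ω) ∂S.P2) / S.Q21 n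

/-- The conditional probability `P(E | Z(n) ≠ 0, Z(0) = e₂)`. -/
noncomputable def Pred (n : ℕ) (E : Set S.Ω) : ℝ :=
  (S.P2 (E ∩ S.surv n)).toReal / S.Q21 n

/-- The birth time `β_n` of the most recent common ancestor of the population
alive at time `n`:  `β_n = max {m < n : Z₁(m,n) + Z₂(m,n) = 1}`. -/
noncomputable def beta (n : ℕ) (ω : S.Ω) : ℕ :=
  sSup {m | m < n ∧ S.R1 m n ω + S.R2 m n ω = 1}

/-- The type `T_n` of the most recent common ancestor: the `i ∈ {1,2}` with
`Z_i(β_n, n) = 1`. -/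
noncomputable def mrcaType (n : ℕ) (ω : S.Ω) : ℕ :=
  if S.R2 (S.beta n ω) n ω = 1 then 2 else 1

/-- Condition (A): `n Q₁(n) = o(Q₂(n))`. -/
def CondA : Prop :=
  Filter.Tendsto (fun n : ℕ => (n : ℝ) * S.Q1 n / S.Q2 n) Filter.atTop (nhds 0)

/-- Condition (B): `Q₂(n) = o(n Q₁(n))`. -/
def CondB : Prop :=
  Filter.Tendsto (fun n : ℕ => S.Q2 n / ((n : ℝ) * S.Q1 n)) Filter.atTop (nhds 0)

/-- Condition (C): `n Q₁(n) ~ σ Q₂(n)`. -/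
def CondC (σ : ℝ) : Prop := Asymp (fun n : ℕ => (n : ℝ) * S.Q1 n) (fun n => σ * S.Q2 n)

/-- `h*` is an integer-valued function with
`(α₁ A₂₁ / (1 - α₁)) h*(n) Q₁(h*(n)) ~ Q₂(n)`. -/
def IsHStar (h : ℕ → ℕ) : Prop :=
  Asymp (fun n : ℕ => S.α1 * S.A21 / (1 - S.α1) * (h n : ℝ) * S.Q1 (h n)) S.Q2

/-- `g*` is an integer-valued function with `Q₂(g*(n)) ~ Q₂₁(n)`. -/
def IsGStar (g : ℕ → ℕ) : Prop := Asymp (fun n => S.Q2 (g n)) S.Q21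

end GWSetup

/-- Analytic properties of `f(x) = F(1-x) - (1-x)` for the offspring generating function `F` of a
critical one-type Galton–Watson process for which `f` is regularly varying at `0` with index
`1 + α`. -/
structure CriticalFun (f : ℝ → ℝ) (α : ℝ) : Prop where
  α_pos : 0 < α
  convex : ConvexOn ℝ (Set.Icc 0 1) f
  zero : f 0 = 0
  mono : MonotoneOn f (Set.Icc 0 1)
  lt_self : ∀ x, 0 < x → x ≤ 1 → f x < x
  sub_mono : MonotoneOn (fun x => x - f x) (Set.Icc 0 1)
  regVar : ∀ c : ℝ, 0 < c → Tendsto (fun x => f (c * x) / f x) (𝓝[>] 0) (𝓝 (c ^ (1 + α)))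

namespace CriticalFun

variable {f : ℝ → ℝ} {α : ℝ} {ι : Type*} {l : Filter ι}

lemma nonneg (hf : CriticalFun f α) {x : ℝ} (h0 : 0 ≤ x) (h1 : x ≤ 1) : 0 ≤ f x := by
  have := hf.mono (Set.left_mem_Icc.2 zero_le_one) ⟨h0, h1⟩ h0
  rwa [hf.zero] at this

lemma pos (hf : CriticalFun f α) {x : ℝ} (h0 : 0 < x) (h1 : x ≤ 1) : 0 < f x := by
  have h := hf.regVar 1 one_pos
  simp only [one_mul, Real.one_rpow] at h
  have h2 : ∀ᶠ y in 𝓝[>] (0 : ℝ), f y ≠ 0 := by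
    filter_upwards [h.eventually (lt_mem_nhds zero_lt_one)] with y hy h3
    simp [h3] at hy
  obtain ⟨y, hy, hy0, hyx⟩ := (h2.and (Ioc_mem_nhdsGT h0)).exists
  have h4 : 0 < f y := lt_of_le_of_ne (hf.nonneg hy0.le (hyx.trans h1)) hy.symm
  exact h4.trans_le (hf.mono ⟨hy0.le, hyx.trans h1⟩ ⟨h0.le, h1⟩ hyx)

lemma div_mono (hf : CriticalFun f α) {x y : ℝ} (h0 : 0 < x) (hxy : x ≤ y) (h1 : y ≤ 1) :
    f x / x ≤ f y / y := by
  have hy : 0 < y := h0.trans_le hxy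
  have h := hf.convex.2 (Set.left_mem_Icc.2 zero_le_one) (show y ∈ Set.Icc (0 : ℝ) 1 from ⟨hy.le, h1⟩)
    (show 0 ≤ 1 - x / y by rw [sub_nonneg, div_le_one hy]; exact hxy) (by positivity)
    (by ring : 1 - x / y + x / y = 1)
  simp only [smul_eq_mul, mul_zero, zero_add, hf.zero] at h
  rw [div_mul_cancel₀ _ hy.ne'] at h
  rw [div_le_div_iff₀ h0 hy]
  calc f x * y ≤ (x / y * f y) * y := by gcongr
    _ = f y * x := by field_simp

lemma tendsto_div (hf : CriticalFun f α) : Tendsto (fun x => f x / x) (𝓝[>] 0) (𝓝 0) := by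
  have hα := hf.α_pos
  set θ : ℝ := 2 * (1 / 2) ^ (1 + α) with hθ
  have hθ1 : θ < 1 := by
    have h1 : ((1 : ℝ) / 2) ^ (1 + α) < (1 / 2) ^ (1 : ℝ) :=
      Real.rpow_lt_rpow_of_exponent_gt (by norm_num) (by norm_num) (by linarith)
    rw [Real.rpow_one] at h1
    rw [hθ]; linarith
  obtain ⟨θ', h1, h2⟩ := exists_between hθ1
  have hθ0 : 0 < θ' := lt_trans (by positivity) h1
  have h3 := (hf.regVar (1 / 2) (by norm_num)).const_mul 2
  have h4 := (h3.eventually (gt_mem_nhds h1)).and (Ioc_mem_nhdsGT (zero_lt_one : (0 : ℝ) < 1))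
  obtain ⟨δ, hδ0, hδ⟩ := mem_nhdsGT_iff_exists_Ioc_subset.1 h4
  have hδ0' : (0 : ℝ) < δ := hδ0
  have hδ1 : δ ≤ 1 := (hδ ⟨hδ0, le_rfl⟩).2.2
  have key : ∀ k : ℕ, f (δ * (1 / 2) ^ k) / (δ * (1 / 2) ^ k) ≤ θ' ^ k * (f δ / δ) := by
    intro k
    induction k with
    | zero => simp
    | succ k ih =>
      set x := δ * (1 / 2 : ℝ) ^ k with hx
      have hx0 : 0 < x := by positivity
      have hxδ : x ≤ δ := by
        rw [hx]; exact mul_le_of_le_one_right hδ0'.le (pow_le_one₀ (by norm_num) (by norm_num))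
      have h5 := (hδ ⟨hx0, hxδ⟩).1
      have hfx := hf.pos hx0 (hxδ.trans hδ1)
      have h6 : δ * (1 / 2 : ℝ) ^ (k + 1) = 1 / 2 * x := by rw [hx]; ring
      rw [h6]
      have h7 : 2 * f (1 / 2 * x) < θ' * f x := by
        have h7 : 2 * (f (1 / 2 * x) / f x) < θ' := h5
        rwa [← mul_div_assoc, div_lt_iff₀ hfx] at h7
      calc f (1 / 2 * x) / (1 / 2 * x) = (2 * f (1 / 2 * x)) / x := by field_simp
        _ ≤ (θ' * f x) / x := by gcongr
        _ = θ' * (f x / x) := by ring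
        _ ≤ θ' * (θ' ^ k * (f δ / δ)) := by gcongr
        _ = _ := by ring
  have h8 : Tendsto (fun k : ℕ => θ' ^ k * (f δ / δ)) atTop (𝓝 0) := by
    simpa using (tendsto_pow_atTop_nhds_zero_of_lt_one hθ0.le h2).mul_const (f δ / δ)
  refine tendsto_order.2 ⟨fun a ha => ?_, fun a ha => ?_⟩
  · filter_upwards [Ioc_mem_nhdsGT (zero_lt_one : (0 : ℝ) < 1)] with x hx
    exact ha.trans_le (div_nonneg (hf.nonneg hx.1.le hx.2) hx.1.le)
  · obtain ⟨k, hk⟩ := (h8.eventually (gt_mem_nhds ha)).exists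
    have hp : 0 < δ * (1 / 2 : ℝ) ^ k := by positivity
    filter_upwards [Ioc_mem_nhdsGT hp] with x hx
    refine lt_of_le_of_lt ((hf.div_mono hx.1 hx.2 ?_).trans (key k)) hk
    exact (mul_le_of_le_one_right hδ0'.le (pow_le_one₀ (by norm_num) (by norm_num))).trans hδ1

/-- Uniformity in the regular variation of `f`. -/
lemma tendsto_ratio (hf : CriticalFun f α) {x z : ι → ℝ} {y : ℝ} (hy : 0 < y)
    (hz : Tendsto z l (𝓝[>] 0)) (hxz : Tendsto (fun i => x i / z i) l (𝓝 y)) :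
    Tendsto (fun i => f (x i) / f (z i)) l (𝓝 (y ^ (1 + α))) := by
  have hα := hf.α_pos
  have hz0 : ∀ᶠ i in l, 0 < z i := hz.eventually self_mem_nhdsWithin
  have hsmall : ∀ c : ℝ, 0 < c → ∀ᶠ i in l, c * z i < 1 := fun c hc => by
    have h1 : Tendsto (fun i => c * z i) l (𝓝 0) := by
      simpa using (tendsto_nhds_of_tendsto_nhdsWithin hz).const_mul c
    exact h1.eventually (gt_mem_nhds one_pos)
  have hcont : ContinuousAt (fun c : ℝ => c ^ (1 + α)) y :=
    Real.continuousAt_rpow_const _ _ (Or.inl hy.ne')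
  refine tendsto_order.2 ⟨fun a ha => ?_, fun a ha => ?_⟩
  · have h1 : ∀ᶠ c in 𝓝[<] y, a < c ^ (1 + α) :=
      (hcont.tendsto.mono_left nhdsWithin_le_nhds).eventually (lt_mem_nhds ha)
    obtain ⟨c, hca, hc0, hcy⟩ := (h1.and (Ioo_mem_nhdsLT hy)).exists
    filter_upwards [((hf.regVar c hc0).comp hz).eventually (lt_mem_nhds hca), hz0,
      hxz.eventually (lt_mem_nhds hcy), hsmall 1 one_pos, hsmall (y + 1) (by linarith),
      hxz.eventually (gt_mem_nhds (lt_add_one y))] with i h2 h3 h4 h5 h6 h7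
    rw [one_mul] at h5
    rw [lt_div_iff₀ h3] at h4
    rw [div_lt_iff₀ h3] at h7
    refine h2.trans_le ?_
    have hfz := hf.pos h3 h5.le
    have : 0 < c * z i := by positivity
    exact div_le_div_of_nonneg_right
      (hf.mono ⟨this.le, by linarith⟩ ⟨by linarith, by linarith⟩ h4.le) hfz.le
  · have h1 : ∀ᶠ c in 𝓝[>] y, c ^ (1 + α) < a :=
      (hcont.tendsto.mono_left nhdsWithin_le_nhds).eventually (gt_mem_nhds ha)
    obtain ⟨c, hca, hcy⟩ := (h1.and self_mem_nhdsWithin).exists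
    have hcy' : y < c := hcy
    filter_upwards [((hf.regVar c (hy.trans hcy')).comp hz).eventually (gt_mem_nhds hca), hz0,
      hxz.eventually (gt_mem_nhds hcy'), hsmall 1 one_pos, hsmall c (hy.trans hcy'),
      hxz.eventually (lt_mem_nhds hy)] with i h2 h3 h4 h5 h6 h7
    rw [one_mul] at h5
    rw [div_lt_iff₀ h3] at h4
    rw [lt_div_iff₀ h3, zero_mul] at h7
    refine lt_of_le_of_lt ?_ h2
    exact div_le_div_of_nonneg_right
      (hf.mono ⟨h7.le, by linarith⟩ ⟨by linarith, by linarith⟩ h4.le) (hf.pos h3 h5.le).le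

lemma tendsto_step_div (hf : CriticalFun f α) :
    Tendsto (fun x => (x - f x) / x) (𝓝[>] 0) (𝓝 1) := by
  have h := hf.tendsto_div.const_sub 1
  rw [sub_zero] at h
  refine h.congr' ?_
  filter_upwards [self_mem_nhdsWithin] with x hx
  have : x ≠ 0 := ne_of_gt hx
  field_simp

lemma tendsto_f_step_div (hf : CriticalFun f α) :
    Tendsto (fun x => f (x - f x) / f x) (𝓝[>] 0) (𝓝 1) := by
  simpa using hf.tendsto_ratio one_pos tendsto_id hf.tendsto_step_div

/-- The difference quotient of `f` over one step is asymptotic to `(1 + α) f(x) / x`. -/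
lemma tendsto_slope (hf : CriticalFun f α) :
    Tendsto (fun x => x * ((f x - f (x - f x)) / f x) / f x) (𝓝[>] 0) (𝓝 (1 + α)) := by
  have hder : HasDerivAt (fun c : ℝ => c ^ (1 + α)) (1 + α) 1 := by
    simpa using Real.hasDerivAt_rpow_const (x := 1) (p := 1 + α) (Or.inl one_ne_zero)
  have hsl := hasDerivAt_iff_tendsto_slope.1 hder
  have hpos : ∀ᶠ x in 𝓝[>] (0 : ℝ), 0 < x ∧ x ≤ 1 := Ioc_mem_nhdsGT one_pos
  have hquot : ∀ c : ℝ, 0 < c → Tendsto (fun x => (f (c * x) / f x - 1) / (c - 1)) (𝓝[>] 0)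
      (𝓝 (slope (fun c : ℝ => c ^ (1 + α)) 1 c)) := fun c hc => by
    have := ((hf.regVar c hc).sub_const 1).div_const (c - 1)
    simpa [slope_def_field] using this
  refine tendsto_order.2 ⟨fun a ha => ?_, fun a ha => ?_⟩
  · have h1 : ∀ᶠ c in 𝓝[<] (1 : ℝ), a < slope (fun c : ℝ => c ^ (1 + α)) 1 c :=
      (hsl.mono_left (nhdsWithin_mono _ fun x hx => ne_of_lt hx)).eventually (lt_mem_nhds ha)
    obtain ⟨c, hca, hc0, hc1⟩ := (h1.and (Ioo_mem_nhdsLT zero_lt_one)).exists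
    filter_upwards [(hquot c hc0).eventually (lt_mem_nhds hca), hpos,
      hf.tendsto_step_div.eventually (lt_mem_nhds hc1)] with x h2 ⟨h3, h4⟩ h5
    rw [lt_div_iff₀ h3] at h5
    have hfx := hf.pos h3 h4
    have h7 : f (c * x) ≤ f x := hf.mono ⟨by positivity, by nlinarith⟩ ⟨h3.le, h4⟩ (by nlinarith)
    refine h2.trans_le ?_
    have h6 := hf.convex.secant_mono (a := x) (x := c * x) (y := x - f x) ⟨h3.le, h4⟩
      ⟨by positivity, by nlinarith⟩ ⟨by nlinarith, by linarith⟩ (by nlinarith) (by linarith)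
      (by linarith)
    have h8 : (f (x - f x) - f x) / (x - f x - x) = (f x - f (x - f x)) / f x := by
      rw [show x - f x - x = -f x by ring, div_neg, ← neg_div, neg_sub]
    rw [h8] at h6
    have h9 : (f (c * x) / f x - 1) / (c - 1) = x * ((f (c * x) - f x) / (c * x - x)) / f x := by
      have : c - 1 ≠ 0 := by linarith
      have : c * x - x ≠ 0 := by nlinarith
      field_simp
    rw [h9]
    gcongr
  · have h1 : ∀ᶠ c in 𝓝[>] (1 : ℝ), slope (fun c : ℝ => c ^ (1 + α)) 1 c < a :=
      (hsl.mono_left (nhdsWithin_mono _ fun x hx => ne_of_gt hx)).eventually (gt_mem_nhds ha)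
    obtain ⟨c, hca, hc1⟩ := (h1.and self_mem_nhdsWithin).exists
    have hc1' : (1 : ℝ) < c := hc1
    have hc0 : (0 : ℝ) < c := one_pos.trans hc1'
    filter_upwards [(hquot c hc0).eventually (gt_mem_nhds hca), hpos,
      Ioc_mem_nhdsGT (show (0 : ℝ) < 1 / c by positivity)] with x h2 ⟨h3, h4⟩ ⟨_, h5⟩
    rw [le_div_iff₀ hc0, mul_comm] at h5
    have hfx := hf.pos h3 h4
    have hlt := hf.lt_self x h3 h4
    refine lt_of_le_of_lt ?_ h2
    have h6 := hf.convex.secant_mono (a := x) (x := x - f x) (y := c * x) ⟨h3.le, h4⟩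
      ⟨by linarith, by linarith⟩ ⟨by positivity, h5⟩ (by linarith) (by nlinarith)
      (by nlinarith)
    have h8 : (f (x - f x) - f x) / (x - f x - x) = (f x - f (x - f x)) / f x := by
      rw [show x - f x - x = -f x by ring, div_neg, ← neg_div, neg_sub]
    rw [h8] at h6
    have h9 : (f (c * x) / f x - 1) / (c - 1) = x * ((f (c * x) - f x) / (c * x - x)) / f x := by
      have : c - 1 ≠ 0 := by linarith
      have : c * x - x ≠ 0 := by nlinarith
      field_simp
    rw [h9]
    gcongr

lemma tendsto_time_step (hf : CriticalFun f α) :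
    Tendsto (fun x => (x - f x) / f (x - f x) - x / f x) (𝓝[>] 0) (𝓝 α) := by
  have h := (hf.tendsto_f_step_div.inv₀ one_ne_zero).mul (hf.tendsto_slope.sub_const 1)
  rw [inv_one, one_mul, add_sub_cancel_left] at h
  refine h.congr' ?_
  filter_upwards [Ioc_mem_nhdsGT (zero_lt_one : (0 : ℝ) < 1)] with x hx
  have h1 := hf.pos hx.1 hx.2
  have h2 := hf.pos (sub_pos.2 (hf.lt_self x hx.1 hx.2)) (by linarith [hx.2] : x - f x ≤ 1)
  have h3 := hx.1.ne'
  field_simp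
  ring

lemma tendsto_sum_step (hf : CriticalFun f α) :
    Tendsto (fun x => (x ^ 2 / f x - (x - f x) ^ 2 / f (x - f x)) / x) (𝓝[>] 0) (𝓝 (1 - α)) := by
  have h := (hf.tendsto_f_step_div.inv₀ one_ne_zero).mul
    ((hf.tendsto_step_div.const_add 1).sub hf.tendsto_slope)
  rw [inv_one, one_mul, show (1 : ℝ) + 1 - (1 + α) = 1 - α by ring] at h
  refine h.congr' ?_
  filter_upwards [Ioc_mem_nhdsGT (zero_lt_one : (0 : ℝ) < 1)] with x hx
  have h1 := hf.pos hx.1 hx.2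
  have h2 := hf.pos (sub_pos.2 (hf.lt_self x hx.1 hx.2)) (by linarith [hx.2] : x - f x ≤ 1)
  have h3 := hx.1.ne'
  field_simp
  ring

/-- The iterates of `x ↦ x - f x`. -/
noncomputable def iter (f : ℝ → ℝ) (n : ℕ) (x : ℝ) : ℝ := (fun x => x - f x)^[n] x

lemma iter_zero (x : ℝ) : iter f 0 x = x := rfl

lemma iter_succ (n : ℕ) (x : ℝ) : iter f (n + 1) x = iter f n x - f (iter f n x) :=
  Function.iterate_succ_apply' _ _ _

lemma iter_add (m n : ℕ) (x : ℝ) : iter f (m + n) x = iter f m (iter f n x) :=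
  Function.iterate_add_apply _ _ _ _

lemma le_self (hf : CriticalFun f α) {x : ℝ} (h0 : 0 ≤ x) (h1 : x ≤ 1) : f x ≤ x := by
  rcases h0.eq_or_lt with rfl | h
  · exact hf.zero.le
  · exact (hf.lt_self x h h1).le

lemma iter_mem_Icc (hf : CriticalFun f α) {x : ℝ} (h0 : 0 ≤ x) (h1 : x ≤ 1) (n : ℕ) :
    0 ≤ iter f n x ∧ iter f n x ≤ x := by
  induction n with
  | zero => exact ⟨h0, le_rfl⟩
  | succ n ih =>
    rw [iter_succ]
    exact ⟨sub_nonneg.2 (hf.le_self ih.1 (ih.2.trans h1)),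
      (sub_le_self _ (hf.nonneg ih.1 (ih.2.trans h1))).trans ih.2⟩

lemma iter_pos (hf : CriticalFun f α) {x : ℝ} (h0 : 0 < x) (h1 : x ≤ 1) (n : ℕ) :
    0 < iter f n x := by
  induction n with
  | zero => exact h0
  | succ n ih =>
    rw [iter_succ]
    exact sub_pos.2 (hf.lt_self _ ih ((hf.iter_mem_Icc h0.le h1 n).2.trans h1))

lemma iter_mono (hf : CriticalFun f α) {x y : ℝ} (h0 : 0 ≤ x) (hxy : x ≤ y) (h1 : y ≤ 1) (n : ℕ) :
    iter f n x ≤ iter f n y := by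
  induction n with
  | zero => exact hxy
  | succ n ih =>
    rw [iter_succ, iter_succ]
    have hx := hf.iter_mem_Icc h0 (hxy.trans h1) n
    have hy := hf.iter_mem_Icc (h0.trans hxy) h1 n
    exact hf.sub_mono ⟨hx.1, hx.2.trans (hxy.trans h1)⟩ ⟨hy.1, hy.2.trans h1⟩ ih

lemma iter_anti (hf : CriticalFun f α) {x : ℝ} (h0 : 0 ≤ x) (h1 : x ≤ 1) :
    Antitone (fun n => iter f n x) := by
  refine antitone_nat_of_succ_le fun n => ?_
  have hx := hf.iter_mem_Icc h0 h1 n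
  rw [iter_succ]
  exact sub_le_self _ (hf.nonneg hx.1 (hx.2.trans h1))

lemma step_le (hf : CriticalFun f α) {a b c : ℝ} (ha : 0 ≤ a) (ha1 : a ≤ 1) (hb : 0 ≤ b)
    (hb1 : b ≤ 1) (hc : 0 ≤ c) (h : b ≤ a + c) : b - f b ≤ a - f a + c := by
  rcases le_total b a with hba | hab
  · have : b - f b ≤ a - f a := hf.sub_mono ⟨hb, hb1⟩ ⟨ha, ha1⟩ hba
    linarith
  · have := hf.mono ⟨ha, ha1⟩ ⟨hb, hb1⟩ hab
    linarith

lemma iter_le_add (hf : CriticalFun f α) {a b c : ℝ} (ha : 0 ≤ a) (ha1 : a ≤ 1) (hb : 0 ≤ b)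
    (hb1 : b ≤ 1) (hc : 0 ≤ c) (h : b ≤ a + c) (n : ℕ) : iter f n b ≤ iter f n a + c := by
  induction n with
  | zero => exact h
  | succ n ih =>
    rw [iter_succ, iter_succ]
    have hx := hf.iter_mem_Icc ha ha1 n
    have hy := hf.iter_mem_Icc hb hb1 n
    exact hf.step_le hx.1 (hx.2.trans ha1) hy.1 (hy.2.trans hb1) hc ih

lemma tendsto_iter_zero (hf : CriticalFun f α) : Tendsto (fun n => iter f n 1) atTop (𝓝 0) := by
  have hmem := hf.iter_mem_Icc zero_le_one le_rfl
  have hbdd : BddBelow (Set.range fun n => iter f n 1) :=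
    ⟨0, by rintro _ ⟨n, rfl⟩; exact (hmem n).1⟩
  have h := tendsto_atTop_ciInf (hf.iter_anti zero_le_one le_rfl) hbdd
  set a := ⨅ n, iter f n 1
  have ha0 : 0 ≤ a := le_ciInf fun n => (hmem n).1
  have hle : ∀ n, a ≤ iter f n 1 := fun n => ciInf_le hbdd n
  rcases ha0.eq_or_lt with h0 | h0
  · rwa [← h0] at h
  · exfalso
    have hfa := hf.pos h0 ((hle 0).trans le_rfl)
    obtain ⟨n, hn⟩ := (h.eventually (gt_mem_nhds (show a < a + f a by linarith))).exists
    have h1 := hle (n + 1)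
    rw [iter_succ] at h1
    have h2 := hf.mono ⟨h0.le, hle 0⟩ ⟨(hmem n).1, (hmem n).2⟩ (hle n)
    linarith

lemma tendsto_iter_zero' (hf : CriticalFun f α) :
    Tendsto (fun n => iter f n 1) atTop (𝓝[>] 0) :=
  tendsto_nhdsWithin_iff.2 ⟨hf.tendsto_iter_zero,
    Eventually.of_forall fun n => hf.iter_pos one_pos le_rfl n⟩

lemma time_anti (hf : CriticalFun f α) {x y : ℝ} (h0 : 0 < x) (hxy : x ≤ y) (h1 : y ≤ 1) :
    y / f y ≤ x / f x := by
  have h := hf.div_mono h0 hxy h1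
  have hx := hf.pos h0 (hxy.trans h1)
  have hy := hf.pos (h0.trans_le hxy) h1
  rw [div_le_div_iff₀ h0 (h0.trans_le hxy)] at h
  rw [div_le_div_iff₀ hy hx]
  linarith

lemma time_pos (hf : CriticalFun f α) {x : ℝ} (h0 : 0 < x) (h1 : x ≤ 1) : 0 < x / f x :=
  div_pos h0 (hf.pos h0 h1)

/-- `x / f x` grows like `α n` along `n` iterations, uniformly in small `x`. -/
lemma time_iter (hf : CriticalFun f α) {ε : ℝ} (hε : 0 < ε) :
    ∃ δ : ℝ, 0 < δ ∧ δ ≤ 1 ∧ ∀ x, 0 < x → x ≤ δ → ∀ n : ℕ,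
      |iter f n x / f (iter f n x) - x / f x - α * n| ≤ ε * n := by
  have h := (hf.tendsto_time_step.eventually (Metric.closedBall_mem_nhds α hε)).and
    (Ioc_mem_nhdsGT (zero_lt_one : (0 : ℝ) < 1))
  obtain ⟨δ, hδ0, hδ⟩ := mem_nhdsGT_iff_exists_Ioc_subset.1 h
  have hδ1 : δ ≤ 1 := (hδ ⟨hδ0, le_rfl⟩).2.2
  refine ⟨δ, hδ0, hδ1, fun x hx0 hxδ n => ?_⟩
  induction n with
  | zero => simp [iter_zero]
  | succ n ih =>
    have h1 := hf.iter_pos hx0 (hxδ.trans hδ1) n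
    have h2 := (hf.iter_mem_Icc hx0.le (hxδ.trans hδ1) n).2.trans hxδ
    have h3 := (hδ ⟨h1, h2⟩).1
    rw [Real.dist_eq] at h3
    rw [iter_succ]
    push_cast
    rw [abs_le] at *
    constructor <;> linarith [ih.1, ih.2, h3.1, h3.2]

/-- The sums of iterates telescope, uniformly in small `x`. -/
lemma sum_iter (hf : CriticalFun f α) {ε : ℝ} (hε : 0 < ε) :
    ∃ δ : ℝ, 0 < δ ∧ δ ≤ 1 ∧ ∀ x, 0 < x → x ≤ δ → ∀ n : ℕ,
      |x ^ 2 / f x - iter f n x ^ 2 / f (iter f n x)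
        - (1 - α) * ∑ k ∈ Finset.range n, iter f k x|
        ≤ ε * ∑ k ∈ Finset.range n, iter f k x := by
  have h := (hf.tendsto_sum_step.eventually (Metric.closedBall_mem_nhds (1 - α) hε)).and
    (Ioc_mem_nhdsGT (zero_lt_one : (0 : ℝ) < 1))
  obtain ⟨δ, hδ0, hδ⟩ := mem_nhdsGT_iff_exists_Ioc_subset.1 h
  have hδ1 : δ ≤ 1 := (hδ ⟨hδ0, le_rfl⟩).2.2
  refine ⟨δ, hδ0, hδ1, fun x hx0 hxδ n => ?_⟩
  induction n with
  | zero => simp [iter_zero]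
  | succ n ih =>
    have h1 := hf.iter_pos hx0 (hxδ.trans hδ1) n
    have h2 := (hf.iter_mem_Icc hx0.le (hxδ.trans hδ1) n).2.trans hxδ
    have h3 := (hδ ⟨h1, h2⟩).1
    rw [Real.dist_eq] at h3
    rw [iter_succ, Finset.sum_range_succ]
    set y := iter f n x
    have h4 : |y ^ 2 / f y - (y - f y) ^ 2 / f (y - f y) - (1 - α) * y| ≤ ε * y := by
      have : y ^ 2 / f y - (y - f y) ^ 2 / f (y - f y) - (1 - α) * y
          = ((y ^ 2 / f y - (y - f y) ^ 2 / f (y - f y)) / y - (1 - α)) * y := by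
        field_simp
      rw [this, abs_mul, abs_of_pos h1]
      gcongr
    rw [abs_le] at *
    constructor <;> linarith [ih.1, ih.2, h4.1, h4.2]

/-- `iter f n 1` satisfies `x / f x ~ α n`. -/
lemma tendsto_time_one (hf : CriticalFun f α) :
    Tendsto (fun n : ℕ => iter f n 1 / f (iter f n 1) / n) atTop (𝓝 α) := by
  rw [Metric.tendsto_atTop']
  intro ε hε
  obtain ⟨δ, hδ0, hδ1, hδ⟩ := hf.time_iter (half_pos hε)
  obtain ⟨N, hN⟩ := (hf.tendsto_iter_zero.eventually (ge_mem_nhds hδ0)).exists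
  set x := iter f N 1 with hx
  set C := |x / f x| + (α + ε / 2) * N with hC
  obtain ⟨K, hK⟩ := exists_nat_gt (C / (ε / 2))
  refine ⟨max N K, fun n hn => ?_⟩
  have hnN : N < n := (le_max_left _ _).trans_lt hn
  have hnK : (K : ℝ) < n := by exact_mod_cast (le_max_right _ _).trans_lt hn
  have hn0 : (0 : ℝ) < n := by exact_mod_cast (Nat.zero_le _).trans_lt hnN
  have h1 := hδ x (hf.iter_pos one_pos le_rfl N) hN (n - N)
  rw [hx, ← iter_add, Nat.sub_add_cancel hnN.le, ← hx, Nat.cast_sub hnN.le] at h1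
  rw [Real.dist_eq]
  set u := iter f n 1 / f (iter f n 1)
  have h2 : |u - α * n| < ε * n := by
    have hα := hf.α_pos
    rw [div_lt_iff₀ (half_pos hε)] at hK
    have h3 : C < n * (ε / 2) := by nlinarith
    have h4 := neg_abs_le (x / f x)
    have h5 := le_abs_self (x / f x)
    have h6 : 0 ≤ ε * N := by positivity
    have h7 : 0 ≤ α * N := by positivity
    rw [abs_le] at h1
    rw [abs_lt]
    constructor <;> nlinarith [h1.1, h1.2]
  rw [show u / n - α = (u - α * n) / n by field_simp, abs_div, abs_of_pos hn0, div_lt_iff₀ hn0]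
  exact h2

lemma tendsto_time_ratio (hf : CriticalFun f α) {x z : ι → ℝ} {y : ℝ} (hy : 0 < y)
    (hz : Tendsto z l (𝓝[>] 0)) (hxz : Tendsto (fun i => x i / z i) l (𝓝 y)) :
    Tendsto (fun i => x i / f (x i) / (z i / f (z i))) l (𝓝 (y ^ (-α))) := by
  have h := hxz.div (hf.tendsto_ratio hy hz hxz) (Real.rpow_pos_of_pos hy _).ne'
  have h1 : y / y ^ (1 + α) = y ^ (-α) := by
    rw [Real.rpow_add hy, Real.rpow_one, Real.rpow_neg hy.le]
    field_simp
  rw [h1] at h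
  refine h.congr fun i => ?_
  simp only [Pi.div_apply]
  rw [div_div_div_comm]

lemma eventually_lt_of_time (hf : CriticalFun f α) {x z : ι → ℝ} {t c : ℝ} (hc : 0 < c)
    (hx : Tendsto x l (𝓝[>] 0)) (hz : Tendsto z l (𝓝[>] 0))
    (h : Tendsto (fun i => x i / f (x i) / (z i / f (z i))) l (𝓝 t)) (hct : c ^ (-α) < t) :
    ∀ᶠ i in l, x i < c * z i := by
  have hz0 : ∀ᶠ i in l, 0 < z i := hz.eventually self_mem_nhdsWithin
  have h1 : Tendsto (fun i => c * z i / z i) l (𝓝 c) :=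
    tendsto_const_nhds.congr' (hz0.mono fun i hi => by field_simp)
  have h2 := hf.tendsto_time_ratio hc hz h1
  filter_upwards [h2.eventually_lt h hct, hz.eventually (Ioc_mem_nhdsGT one_pos),
    hx.eventually (Ioc_mem_nhdsGT one_pos)] with i h3 h4 h5
  by_contra! h6
  have h7 := hf.time_anti (mul_pos hc h4.1) h6 h5.2
  have h8 := hf.time_pos h4.1 h4.2
  rw [div_lt_div_iff_of_pos_right h8] at h3
  linarith

lemma eventually_gt_of_time (hf : CriticalFun f α) {x z : ι → ℝ} {t c : ℝ} (hc : 0 < c)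
    (hx : Tendsto x l (𝓝[>] 0)) (hz : Tendsto z l (𝓝[>] 0))
    (h : Tendsto (fun i => x i / f (x i) / (z i / f (z i))) l (𝓝 t)) (hct : t < c ^ (-α)) :
    ∀ᶠ i in l, c * z i < x i := by
  have hz0 : ∀ᶠ i in l, 0 < z i := hz.eventually self_mem_nhdsWithin
  have h1 : Tendsto (fun i => c * z i / z i) l (𝓝 c) :=
    tendsto_const_nhds.congr' (hz0.mono fun i hi => by field_simp)
  have h2 := hf.tendsto_time_ratio hc hz h1
  have h0 : Tendsto (fun i => c * z i) l (𝓝 0) := by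
    simpa using (tendsto_nhds_of_tendsto_nhdsWithin hz).const_mul c
  filter_upwards [h.eventually_lt h2 hct, hz.eventually (Ioc_mem_nhdsGT one_pos),
    hx.eventually (Ioc_mem_nhdsGT one_pos), h0.eventually (ge_mem_nhds one_pos)] with i h3 h4 h5 h9
  by_contra! h6
  have h7 := hf.time_anti h5.1 h6 h9
  have h8 := hf.time_pos h4.1 h4.2
  rw [div_lt_div_iff_of_pos_right h8] at h3
  linarith

/-- Inversion of the regularly varying function `x / f x`. -/
lemma tendsto_div_of_time (hf : CriticalFun f α) {x z : ι → ℝ} {t : ℝ} (ht : 0 < t)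
    (hx : Tendsto x l (𝓝[>] 0)) (hz : Tendsto z l (𝓝[>] 0))
    (h : Tendsto (fun i => x i / f (x i) / (z i / f (z i))) l (𝓝 t)) :
    Tendsto (fun i => x i / z i) l (𝓝 (t ^ (-1 / α))) := by
  have hα := hf.α_pos
  have hz0 : ∀ᶠ i in l, 0 < z i := hz.eventually self_mem_nhdsWithin
  have hx0 : ∀ᶠ i in l, 0 < x i := hx.eventually self_mem_nhdsWithin
  have hexp : -1 / α ≤ 0 := by rw [neg_div]; simp [hα.le]
  have hinv : ∀ c : ℝ, 0 < c → (c ^ (-α)) ^ (-1 / α) = c := fun c hc => by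
    rw [← Real.rpow_mul hc.le, show -α * (-1 / α) = 1 by field_simp, Real.rpow_one]
  refine tendsto_order.2 ⟨fun a ha => ?_, fun a ha => ?_⟩
  · rcases le_or_gt a 0 with h0 | h0
    · filter_upwards [hz0, hx0] with i h1 h2
      exact h0.trans_lt (div_pos h2 h1)
    · have h1 : t < a ^ (-α) := by
        by_contra! h1
        have := Real.rpow_le_rpow_of_nonpos (Real.rpow_pos_of_pos h0 _) h1 hexp
        rw [hinv a h0] at this
        linarith
      filter_upwards [hf.eventually_gt_of_time h0 hx hz h h1, hz0] with i h2 h3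
      rwa [lt_div_iff₀ h3]
  · have h0 : 0 < a := (Real.rpow_pos_of_pos ht _).trans ha
    have h1 : a ^ (-α) < t := by
      by_contra! h1
      have := Real.rpow_le_rpow_of_nonpos ht h1 hexp
      rw [hinv a h0] at this
      linarith
    filter_upwards [hf.eventually_lt_of_time h0 hx hz h h1, hz0] with i h2 h3
    rwa [div_lt_iff₀ h3]

lemma tendsto_div_zero_of_time (hf : CriticalFun f α) {x z : ι → ℝ}
    (hx : Tendsto x l (𝓝[>] 0)) (hz : Tendsto z l (𝓝[>] 0))
    (h : Tendsto (fun i => x i / f (x i) / (z i / f (z i))) l (𝓝 0)) :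
    Tendsto (fun i => z i / x i) l (𝓝 0) := by
  have hz0 : ∀ᶠ i in l, 0 < z i := hz.eventually self_mem_nhdsWithin
  have hx0 : ∀ᶠ i in l, 0 < x i := hx.eventually self_mem_nhdsWithin
  refine tendsto_order.2 ⟨fun a ha => ?_, fun a ha => ?_⟩
  · filter_upwards [hz0, hx0] with i h1 h2
    exact ha.trans (div_pos h1 h2)
  · have hc : 0 < a⁻¹ := inv_pos.2 ha
    filter_upwards [hf.eventually_gt_of_time hc hx hz h (Real.rpow_pos_of_pos hc _), hx0]
      with i h1 h2
    rw [inv_mul_lt_iff₀ ha] at h1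
    rwa [div_lt_iff₀ h2]

/-- `x / f x` after `k` iterations, when `k` and the initial value are comparable to `n`. -/
lemma tendsto_time_iter (hf : CriticalFun f α) {x : ℕ → ℝ} {k : ℕ → ℕ} {a κ : ℝ}
    (hx : Tendsto x atTop (𝓝[>] 0))
    (ha : Tendsto (fun n : ℕ => x n / f (x n) / n) atTop (𝓝 (α * a)))
    (hk : Tendsto (fun n : ℕ => (k n : ℝ) / n) atTop (𝓝 κ)) :
    Tendsto (fun n : ℕ => iter f (k n) (x n) / f (iter f (k n) (x n)) / n) atTop
      (𝓝 (α * (a + κ))) := by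
  have h1 : Tendsto (fun n : ℕ => iter f (k n) (x n) / f (iter f (k n) (x n)) / n
      - x n / f (x n) / n - α * (k n / n)) atTop (𝓝 0) := by
    rw [Metric.tendsto_nhds]
    intro ε hε
    have hκ : 0 ≤ κ := ge_of_tendsto' hk fun n => by positivity
    obtain ⟨δ, hδ0, hδ1, hδ⟩ := hf.time_iter (show 0 < ε / (κ + 1) by positivity)
    filter_upwards [hx.eventually (Ioc_mem_nhdsGT hδ0), hk.eventually (gt_mem_nhds (lt_add_one κ)),
      eventually_gt_atTop 0] with n h2 h3 h4
    have h4' : (0 : ℝ) < n := by exact_mod_cast h4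
    have h5 := hδ (x n) h2.1 h2.2 (k n)
    rw [Real.dist_eq, sub_zero]
    rw [show ∀ u v w : ℝ, u / n - v / n - α * (w / n) = (u - v - α * w) / n from
      fun u v w => by ring, abs_div, abs_of_pos h4']
    calc _ ≤ ε / (κ + 1) * k n / n := by gcongr
      _ = ε / (κ + 1) * (k n / n) := by ring
      _ < ε / (κ + 1) * (κ + 1) := by gcongr
      _ = ε := by field_simp
  have h2 := (h1.add ha).add (hk.const_mul α)
  rw [show 0 + α * a + α * κ = α * (a + κ) by ring] at h2
  refine h2.congr fun n => by ring

lemma tendsto_div_of_time_nat (hf : CriticalFun f α) {z : ℕ → ℝ} {t : ℝ} (ht : 0 < t)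
    (hz : Tendsto z atTop (𝓝[>] 0))
    (h : Tendsto (fun n : ℕ => z n / f (z n) / n) atTop (𝓝 (α * t))) :
    Tendsto (fun n => z n / iter f n 1) atTop (𝓝 (t ^ (-1 / α))) := by
  have hα := hf.α_pos
  refine hf.tendsto_div_of_time ht hz hf.tendsto_iter_zero' ?_
  have h1 := h.div hf.tendsto_time_one hα.ne'
  rw [mul_div_cancel_left₀ _ hα.ne'] at h1
  refine h1.congr' ?_
  filter_upwards [eventually_gt_atTop 0] with n hn
  have : (n : ℝ) ≠ 0 := by exact_mod_cast hn.ne'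
  simp only [Pi.div_apply]
  rw [div_div_div_cancel_right₀ this]

/-- The flow `iter f` started from a multiple of `iter f n 1`. -/
lemma tendsto_iter_div (hf : CriticalFun f α) {x : ℕ → ℝ} {k : ℕ → ℕ} {y κ : ℝ} (hy : 0 < y)
    (hx : Tendsto (fun n => x n / iter f n 1) atTop (𝓝 y))
    (hk : Tendsto (fun n : ℕ => (k n : ℝ) / n) atTop (𝓝 κ)) :
    Tendsto (fun n => iter f (k n) (x n) / iter f n 1) atTop
      (𝓝 ((κ + y ^ (-α)) ^ (-1 / α))) := by
  have hκ : 0 ≤ κ := ge_of_tendsto' hk fun n => by positivity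
  have hpos := hf.iter_pos one_pos le_rfl
  have hx0 : Tendsto x atTop (𝓝 0) := by
    have := hx.mul hf.tendsto_iter_zero
    rw [mul_zero] at this
    exact this.congr fun n => div_mul_cancel₀ _ (hpos n).ne'
  have hxpos : ∀ᶠ n in atTop, 0 < x n := by
    filter_upwards [hx.eventually (lt_mem_nhds hy)] with n hn
    rwa [lt_div_iff₀ (hpos n), zero_mul] at hn
  have hx' : Tendsto x atTop (𝓝[>] 0) := tendsto_nhdsWithin_iff.2 ⟨hx0, hxpos⟩
  have h1 : Tendsto (fun n : ℕ => x n / f (x n) / n) atTop (𝓝 (α * y ^ (-α))) := by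
    have := (hf.tendsto_time_ratio hy hf.tendsto_iter_zero' hx).mul hf.tendsto_time_one
    rw [mul_comm] at this
    refine this.congr fun n => ?_
    have h2 := (hf.time_pos (hpos n) (hf.iter_mem_Icc zero_le_one le_rfl n).2).ne'
    generalize iter f n 1 / f (iter f n 1) = b at *
    field_simp
  have h2 := hf.tendsto_time_iter hx' h1 hk
  rw [add_comm (y ^ (-α)) κ] at h2
  have h3 : 0 < y ^ (-α) := Real.rpow_pos_of_pos hy _
  refine hf.tendsto_div_of_time_nat (by linarith) ?_ h2
  rw [tendsto_nhdsWithin_iff]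
  have hsm := hx0.eventually (ge_mem_nhds one_pos)
  constructor
  · refine tendsto_of_tendsto_of_tendsto_of_le_of_le' tendsto_const_nhds hx0 ?_ ?_
    · filter_upwards [hxpos, hsm] with n h4 h5 using (hf.iter_mem_Icc h4.le h5 _).1
    · filter_upwards [hxpos, hsm] with n h4 h5 using (hf.iter_mem_Icc h4.le h5 _).2
  · filter_upwards [hxpos, hsm] with n h4 h5 using hf.iter_pos h4 h5 _

lemma tendsto_iter_one_div (hf : CriticalFun f α) {k : ℕ → ℕ} {κ : ℝ} (hκ : 0 < κ)
    (hk : Tendsto (fun n : ℕ => (k n : ℝ) / n) atTop (𝓝 κ)) :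
    Tendsto (fun n => iter f (k n) 1 / iter f n 1) atTop (𝓝 (κ ^ (-1 / α))) := by
  have hkt : Tendsto k atTop atTop := by
    have h1 : Tendsto (fun n : ℕ => (k n : ℝ) / n * n) atTop atTop :=
      hk.pos_mul_atTop hκ tendsto_natCast_atTop_atTop
    refine tendsto_natCast_atTop_iff.1 (h1.congr' ?_)
    filter_upwards [eventually_gt_atTop 0] with n hn
    have : (n : ℝ) ≠ 0 := by exact_mod_cast hn.ne'
    field_simp
  refine hf.tendsto_div_of_time_nat hκ (hf.tendsto_iter_zero'.comp hkt) ?_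
  refine ((hf.tendsto_time_one.comp hkt).mul hk).congr' ?_
  filter_upwards [hkt.eventually_gt_atTop 0] with n hn
  have : (k n : ℝ) ≠ 0 := by exact_mod_cast hn.ne'
  simp only [Function.comp_apply]
  rw [div_mul_div_cancel₀ this]

/-- If `k n ≪ n` then `iter f n 1 ≪ iter f (k n) 1`. -/
lemma tendsto_iter_one_div_zero (hf : CriticalFun f α) {j k : ℕ → ℕ} (hk : Tendsto k atTop atTop)
    (hj : Tendsto j atTop atTop)
    (hjk : Tendsto (fun n : ℕ => (k n : ℝ) / j n) atTop (𝓝 0)) :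
    Tendsto (fun n => iter f (j n) 1 / iter f (k n) 1) atTop (𝓝 0) := by
  have hα := hf.α_pos
  refine hf.tendsto_div_zero_of_time (hf.tendsto_iter_zero'.comp hk)
    (hf.tendsto_iter_zero'.comp hj) ?_
  have h := ((hf.tendsto_time_one.comp hk).div (hf.tendsto_time_one.comp hj) hα.ne').mul hjk
  rw [mul_zero] at h
  refine h.congr' ?_
  filter_upwards [hk.eventually_gt_atTop 0, hj.eventually_gt_atTop 0] with n hn hn'
  have h1 : (k n : ℝ) ≠ 0 := by exact_mod_cast hn.ne'
  have h2 : (j n : ℝ) ≠ 0 := by exact_mod_cast hn'.ne'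
  have h3 := (hf.time_pos (hf.iter_pos one_pos le_rfl (j n))
    (hf.iter_mem_Icc zero_le_one le_rfl (j n)).2).ne'
  simp only [Function.comp_apply, Pi.div_apply]
  generalize iter f (j n) 1 / f (iter f (j n) 1) = b at *
  field_simp

/-- The sum of iterates of a small value. -/
lemma tendsto_sum_iter (hf : CriticalFun f α) {x : ι → ℝ} {k : ι → ℕ}
    (hx : Tendsto x l (𝓝[>] 0)) (hk : ∀ᶠ i in l, 0 < k i) :
    Tendsto (fun i => (x i ^ 2 / f (x i) - iter f (k i) (x i) ^ 2 / f (iter f (k i) (x i)))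
      / ∑ j ∈ Finset.range (k i), iter f j (x i)) l (𝓝 (1 - α)) := by
  rw [Metric.tendsto_nhds]
  intro ε hε
  obtain ⟨δ, hδ0, hδ1, hδ⟩ := hf.sum_iter (half_pos hε)
  filter_upwards [hx.eventually (Ioc_mem_nhdsGT hδ0), hk] with i h1 h2
  have h3 := hδ (x i) h1.1 h1.2 (k i)
  have h4 : 0 < ∑ j ∈ Finset.range (k i), iter f j (x i) :=
    Finset.sum_pos (fun j _ => hf.iter_pos h1.1 (h1.2.trans hδ1) j) (by simpa using h2.ne')
  rw [Real.dist_eq]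
  set T := ∑ j ∈ Finset.range (k i), iter f j (x i)
  rw [show ∀ w : ℝ, w / T - (1 - α) = (w - (1 - α) * T) / T from fun w => by field_simp,
    abs_div, abs_of_pos h4, div_lt_iff₀ h4]
  exact h3.trans_lt (by gcongr; linarith)

end CriticalFun

section GeneratingFunction

variable {Ω : Type*} [MeasurableSpace Ω] {P : Measure Ω} [IsProbabilityMeasure P] {Y Z : Ω → ℕ}

lemma integrable_pow_mul_pow (hY : Measurable Y) (hZ : Measurable Z) {s t : ℝ} (hs : 0 ≤ s)
    (hs1 : s ≤ 1) (ht : 0 ≤ t) (ht1 : t ≤ 1) :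
    Integrable (fun ω => s ^ Y ω * t ^ Z ω) P := by
  have hm : Measurable fun ω => s ^ Y ω * t ^ Z ω :=
    ((measurable_from_nat (f := fun k => s ^ k)).comp hY).mul
      ((measurable_from_nat (f := fun k => t ^ k)).comp hZ)
  refine Integrable.of_bound hm.aestronglyMeasurable 1 (Eventually.of_forall fun ω => ?_)
  rw [Real.norm_eq_abs, abs_of_nonneg (by positivity)]
  exact mul_le_one₀ (pow_le_one₀ hs hs1) (by positivity) (pow_le_one₀ ht ht1)

lemma integrable_pow (hZ : Measurable Z) {s : ℝ} (hs : 0 ≤ s) (hs1 : s ≤ 1) :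
    Integrable (fun ω => s ^ Z ω) P := by
  simpa using integrable_pow_mul_pow (P := P) hZ hZ hs hs1 zero_le_one le_rfl

lemma pow_sub_pow_le_mul {s t : ℝ} (hs : 0 ≤ s) (hst : s ≤ t) (ht : t ≤ 1) (k : ℕ) :
    t ^ k - s ^ k ≤ k * (t - s) := by
  induction k with
  | zero => simp
  | succ k ih =>
    have h1 : s ^ k ≤ 1 := pow_le_one₀ hs (hst.trans ht)
    have h2 : s ^ k ≤ t ^ k := pow_le_pow_left₀ hs hst k
    push_cast
    have h3 : t ^ (k + 1) - s ^ (k + 1) = t * (t ^ k - s ^ k) + (t - s) * s ^ k := by ring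
    rw [h3]
    nlinarith

lemma criticalFun_of_pgf (hZ : Measurable Z) (hmean : ∫ ω, (Z ω : ℝ) ∂P = 1) {α : ℝ} {L : ℝ → ℝ}
    (hα : 0 < α)
    (hF : ∀ s : ℝ, 0 ≤ s → s < 1 → ∫ ω, s ^ Z ω ∂P = s + (1 - s) ^ (1 + α) * L (1 - s))
    (hL : ∀ c : ℝ, 0 < c → Tendsto (fun x => L (c * x) / L x) (𝓝[>] 0) (𝓝 1)) :
    CriticalFun (fun x => ∫ ω, (1 - x) ^ Z ω ∂P - (1 - x)) α := by
  have hpow : ∀ x ∈ Set.Icc (0 : ℝ) 1, Integrable (fun ω => (1 - x) ^ Z ω) P := fun x hx =>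
    integrable_pow hZ (by linarith [hx.2]) (by linarith [hx.1])
  have hZint : Integrable (fun ω => (Z ω : ℝ)) P :=
    not_not.1 fun h => by simp [integral_undef h] at hmean
  refine ⟨hα, ⟨convex_Icc _ _, fun x hx y hy a b ha hb hab => ?_⟩, by simp, fun x hx y hy hxy => ?_,
    fun x hx0 hx1 => ?_, fun x hx y hy hxy => ?_, fun c hc => ?_⟩
  · have h1 : ∫ ω, (1 - (a • x + b • y)) ^ Z ω ∂P
        ≤ ∫ ω, (a * (1 - x) ^ Z ω + b * (1 - y) ^ Z ω) ∂P := by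
      refine integral_mono (hpow _ (convex_Icc (0 : ℝ) 1 hx hy ha hb hab))
        (((hpow x hx).const_mul a).add ((hpow y hy).const_mul b)) fun ω => ?_
      have := (convexOn_pow (𝕜 := ℝ) (Z ω)).2 (x := 1 - x) (y := 1 - y)
        (by simpa using hx.2) (by simpa using hy.2) ha hb hab
      simp only [smul_eq_mul] at this ⊢
      rwa [show 1 - (a * x + b * y) = a * (1 - x) + b * (1 - y) by linear_combination -hab]
    rw [integral_add ((hpow x hx).const_mul a) ((hpow y hy).const_mul b), integral_const_mul,
      integral_const_mul] at h1
    simp only [smul_eq_mul] at h1 ⊢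
    linear_combination h1 + hab
  · have h1 : ∫ ω, ((1 - x) ^ Z ω - (1 - y) ^ Z ω) ∂P ≤ ∫ ω, (Z ω : ℝ) * (y - x) ∂P := by
      refine integral_mono ((hpow x hx).sub (hpow y hy)) (hZint.mul_const _) fun ω => ?_
      have := pow_sub_pow_le_mul (s := 1 - y) (t := 1 - x) (by linarith [hy.2]) (by linarith)
        (by linarith [hx.1]) (Z ω)
      simpa using this
    rw [integral_sub (hpow x hx) (hpow y hy), integral_mul_const, hmean] at h1
    linarith
  · have hx : x ∈ Set.Icc (0 : ℝ) 1 := ⟨hx0.le, hx1⟩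
    have h0 : ∀ ω, 0 ≤ 1 - (1 - x) ^ Z ω := fun ω =>
      sub_nonneg.2 (pow_le_one₀ (by linarith) (by linarith))
    have h1 : 0 < ∫ ω, (1 - (1 - x) ^ Z ω) ∂P := by
      refine lt_of_le_of_ne (integral_nonneg h0) fun h => ?_
      have h2 := (integral_eq_zero_iff_of_nonneg h0 ((integrable_const 1).sub (hpow x hx))).1 h.symm
      have h3 : ∫ ω, (Z ω : ℝ) ∂P = 0 := by
        refine integral_eq_zero_of_ae (h2.mono fun ω hω => ?_)
        by_contra h4
        have h5 : Z ω ≠ 0 := fun h => h4 (by simp [h])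
        have h6 : (1 - x) ^ Z ω < 1 := pow_lt_one₀ (by linarith) (by linarith) h5
        simp only [Pi.zero_apply] at hω
        linarith
      rw [h3] at hmean
      exact zero_ne_one hmean
    rw [integral_sub (integrable_const _) (hpow x hx)] at h1
    simp at h1
    linarith
  · have h1 : ∫ ω, (1 - y) ^ Z ω ∂P ≤ ∫ ω, (1 - x) ^ Z ω ∂P :=
      integral_mono (hpow y hy) (hpow x hx) fun ω =>
        pow_le_pow_left₀ (by linarith [hy.2]) (by linarith) _
    simp only
    linarith
  · have h1 := (hL c hc).const_mul (c ^ (1 + α))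
    rw [mul_one] at h1
    refine h1.congr' ?_
    filter_upwards [Ioc_mem_nhdsGT one_pos, Ioc_mem_nhdsGT (show (0 : ℝ) < 1 / c by positivity)]
      with x hx hxc
    have hcx : c * x ≤ 1 := by
      have := hxc.2
      rwa [le_div_iff₀ hc, mul_comm] at this
    have hcx0 : 0 < c * x := mul_pos hc hx.1
    rw [hF (1 - c * x) (by linarith) (by linarith), hF (1 - x) (by linarith [hx.2])
      (by linarith [hx.1])]
    simp only [sub_sub_cancel, add_sub_cancel_left]
    rw [Real.mul_rpow hc.le hx.1.le]
    have : x ^ (1 + α) ≠ 0 := (Real.rpow_pos_of_pos hx.1 _).ne'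
    rw [mul_assoc, mul_left_comm, mul_div_mul_left _ _ this, mul_div_assoc]

end GeneratingFunction

namespace GWSetup

attribute [local instance] GWSetup.mΩ GWSetup.hprob1 GWSetup.hprob2

variable (S : GWSetup)

/-- `f₁(x) = F₁(1-x) - (1-x)`. -/
noncomputable def f1 (x : ℝ) : ℝ := ∫ ω, (1 - x) ^ S.Z1 1 ω ∂S.P1 - (1 - x)

/-- `f₂(x) = F₂₁(1,1-x) - (1-x)`. -/
noncomputable def f2 (x : ℝ) : ℝ := ∫ ω, (1 - x) ^ S.Z2 1 ω ∂S.P2 - (1 - x)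

lemma criticalFun_f1 : CriticalFun S.f1 S.α1 :=
  criticalFun_of_pgf (S.mZ1 1) S.hcrit1 S.hα1.1 S.hF1 S.hL1

lemma criticalFun_f2 : CriticalFun S.f2 S.α2 :=
  criticalFun_of_pgf (S.mZ2 1) S.hcrit2 S.hα2.1
    (fun s hs hs1 => by simpa using S.hF2 1 s zero_le_one le_rfl hs hs1) S.hL2

open CriticalFun

lemma F21_mem (n : ℕ) {s1 s2 : ℝ} (h1 : 0 ≤ s1) (h1' : s1 ≤ 1) (h2 : 0 ≤ s2) (h2' : s2 ≤ 1) :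
    0 ≤ S.F21 n s1 s2 ∧ S.F21 n s1 s2 ≤ 1 := by
  refine ⟨integral_nonneg fun ω => by positivity, ?_⟩
  have := integral_mono (integrable_pow_mul_pow (P := S.P2) (S.mZ1 n) (S.mZ2 n) h1 h1' h2 h2')
    (integrable_const 1) fun ω =>
      mul_le_one₀ (pow_le_one₀ h1 h1') (by positivity) (pow_le_one₀ h2 h2')
  rw [integral_const, probReal_univ, one_smul] at this
  exact this

lemma F1_eq (n : ℕ) {x : ℝ} (h0 : 0 ≤ x) (h1 : x ≤ 1) :
    S.F1 n (1 - x) = 1 - iter S.f1 n x := by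
  induction n with
  | zero =>
    have : S.F1 0 (1 - x) = ∫ _, (1 - x) ∂S.P1 :=
      integral_congr_ae (S.hinit1.mono fun ω hω => by simp [hω.1])
    simp [this, iter_zero]
  | succ n ih =>
    have h := S.hbranch1 1 n (1 - x) (by linarith) (by linarith)
    rw [add_comm 1 n] at h
    change S.F1 (n + 1) (1 - x) = ∫ ω, S.F1 n (1 - x) ^ S.Z1 1 ω ∂S.P1 at h
    rw [h, ih, iter_succ, f1]
    ring

lemma F1_one (n : ℕ) : S.F1 n 1 = 1 := by simp [F1]

lemma F21_zero (s1 s2 : ℝ) : S.F21 0 s1 s2 = s2 := by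
  have : S.F21 0 s1 s2 = ∫ _, s2 ∂S.P2 :=
    integral_congr_ae (S.hinit2.mono fun ω hω => by simp [hω.1, hω.2])
  simp [this]

lemma F21_succ (n : ℕ) {s1 s2 : ℝ} (h1 : 0 ≤ s1) (h1' : s1 ≤ 1) (h2 : 0 ≤ s2) (h2' : s2 ≤ 1) :
    S.F21 (n + 1) s1 s2 = S.F21 1 (S.F1 n s1) (S.F21 n s1 s2) := by
  rw [add_comm n 1]
  exact S.hbranch2 1 n s1 s2 h1 h1' h2 h2'

lemma F21_one_eq (n : ℕ) {x : ℝ} (h0 : 0 ≤ x) (h1 : x ≤ 1) :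
    S.F21 n 1 (1 - x) = 1 - iter S.f2 n x := by
  induction n with
  | zero => rw [F21_zero, iter_zero]
  | succ n ih =>
    rw [S.F21_succ n zero_le_one le_rfl (by linarith) (by linarith), F1_one, ih, iter_succ, F21, f2]
    simp only [one_pow, one_mul]
    ring

lemma one_sub_F21_le {a b : ℝ} (ha : 0 ≤ a) (ha1 : a ≤ 1) (hb : 0 ≤ b) (hb1 : b ≤ 1) :
    1 - S.F21 1 (1 - a) (1 - b) ≤ b - S.f2 b + S.A21 * a := by
  have hpow : Integrable (fun ω => (S.Z1 1 ω : ℝ)) S.P2 :=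
    not_not.1 fun h => by
      have := S.hmean21
      rw [integral_undef h] at this
      exact S.hA21.ne this
  have hi2 := integrable_pow (P := S.P2) (S.mZ2 1) (show 0 ≤ 1 - b by linarith) (by linarith)
  have h1 : ∫ ω, ((1 - b) ^ S.Z2 1 ω - S.Z1 1 ω * a) ∂S.P2 ≤ S.F21 1 (1 - a) (1 - b) := by
    refine integral_mono (hi2.sub (hpow.mul_const a))
      (integrable_pow_mul_pow (S.mZ1 1) (S.mZ2 1) (by linarith) (by linarith) (by linarith)
        (by linarith)) fun ω => ?_
    have h2 := pow_sub_pow_le_mul (s := 1 - a) (t := 1) (by linarith) (by linarith) le_rfl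
      (S.Z1 1 ω)
    have h3 : (1 - b) ^ S.Z2 1 ω ≤ 1 := pow_le_one₀ (by linarith) (by linarith)
    have h4 : 0 ≤ (1 - b) ^ S.Z2 1 ω := pow_nonneg (by linarith) _
    have h5 : (1 - a) ^ S.Z1 1 ω ≤ 1 := pow_le_one₀ (by linarith) (by linarith)
    simp only [one_pow, sub_sub_cancel] at h2 ⊢
    nlinarith
  rw [integral_sub hi2 (hpow.mul_const a), integral_mul_const, S.hmean21] at h1
  rw [f2]
  linarith

lemma le_one_sub_F21 {a b : ℝ} (ha : 0 ≤ a) (ha1 : a ≤ 1) (hb : 0 ≤ b) (hb1 : b ≤ 1) :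
    b - S.f2 b ≤ 1 - S.F21 1 (1 - a) (1 - b) := by
  have h1 : S.F21 1 (1 - a) (1 - b) ≤ ∫ ω, (1 - b) ^ S.Z2 1 ω ∂S.P2 :=
    integral_mono
      (integrable_pow_mul_pow (S.mZ1 1) (S.mZ2 1) (by linarith) (by linarith) (by linarith)
        (by linarith))
      (integrable_pow (S.mZ2 1) (by linarith) (by linarith)) fun ω =>
        mul_le_of_le_one_left (pow_nonneg (by linarith) _) (pow_le_one₀ (by linarith) (by linarith))
  rw [f2]
  linarith

lemma one_sub_F21_eq {a b : ℝ} (ha : 0 ≤ a) (ha1 : a ≤ 1) (hb : 0 < b) (hb1 : b ≤ 1) :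
    1 - S.F21 1 (1 - a) (1 - b) = b - S.f2 b + (S.A21 - S.ρ (1 - a) (1 - b)) * a := by
  have h1 := S.hF2 (1 - a) (1 - b) (by linarith) (by linarith) (by linarith) (by linarith)
  have h2 := S.hF2 1 (1 - b) (by linarith) (by linarith) (by linarith) (by linarith)
  simp only [one_pow, one_mul, sub_self, mul_zero, sub_zero] at h2
  rw [F21, h1, f2, h2]
  ring

lemma Q1_eq (n : ℕ) : S.Q1 n = iter S.f1 n 1 := by
  have h := S.F1_eq n zero_le_one le_rfl
  have hm : MeasurableSet {ω | S.Z1 n ω ≠ 0} := S.mZ1 n (MeasurableSet.of_discrete (s := {0}ᶜ))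
  have h1 : S.F1 n (1 - 1) = ∫ ω, (1 - {ω | S.Z1 n ω ≠ 0}.indicator (fun _ => (1 : ℝ)) ω) ∂S.P1 := by
    refine integral_congr_ae (Eventually.of_forall fun ω => ?_)
    by_cases hω : S.Z1 n ω = 0 <;> simp [hω]
  rw [integral_sub (integrable_const _) ((integrable_const _).indicator hm),
    integral_indicator_const _ hm] at h1
  simp [Measure.real] at h1 h
  rw [Q1]
  simp
  linarith

lemma Q2_eq (n : ℕ) : S.Q2 n = iter S.f2 n 1 := by
  have h := S.F21_one_eq n zero_le_one le_rfl
  have hm : MeasurableSet {ω | S.Z2 n ω ≠ 0} := S.mZ2 n (MeasurableSet.of_discrete (s := {0}ᶜ))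
  have h1 : S.F21 n 1 (1 - 1)
      = ∫ ω, (1 - {ω | S.Z2 n ω ≠ 0}.indicator (fun _ => (1 : ℝ)) ω) ∂S.P2 := by
    refine integral_congr_ae (Eventually.of_forall fun ω => ?_)
    by_cases hω : S.Z2 n ω = 0 <;> simp [hω]
  rw [integral_sub (integrable_const _) ((integrable_const _).indicator hm),
    integral_indicator_const _ hm] at h1
  simp [Measure.real] at h1 h
  rw [Q2]
  simp
  linarith

lemma measurableSet_surv (n : ℕ) : MeasurableSet (S.surv n) :=
  (S.mZ1 n (MeasurableSet.of_discrete (s := {0}ᶜ))).union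
    (S.mZ2 n (MeasurableSet.of_discrete (s := {0}ᶜ)))

lemma Q21_eq (n : ℕ) : S.Q21 n = S.Q21s n (1 - 1) (1 - 1) := by
  have hm := S.measurableSet_surv n
  have h1 : S.F21 n (1 - 1) (1 - 1)
      = ∫ ω, (1 - (S.surv n).indicator (fun _ => (1 : ℝ)) ω) ∂S.P2 := by
    refine integral_congr_ae (Eventually.of_forall fun ω => ?_)
    by_cases hω : S.Z1 n ω = 0 <;> by_cases hω' : S.Z2 n ω = 0 <;>
      simp [hω, hω', surv, Set.indicator]
  rw [integral_sub (integrable_const _) ((integrable_const _).indicator hm),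
    integral_indicator_const _ hm] at h1
  rw [Q21s, h1, Q21]
  simp [Measure.real]

lemma Ered_eq {m n : ℕ} (hmn : m ≤ n) (hQ : S.Q21 n ≠ 0) {c d : ℝ} (hc : 0 ≤ c) (hd : 0 ≤ d) :
    S.Ered m n (fun k l => Real.exp (-c * (k : ℝ) - d * (l : ℝ)))
      = 1 - S.Q21s m (1 - (1 - Real.exp (-c)) * S.Q1 (n - m))
          (1 - (1 - Real.exp (-d)) * S.Q21 (n - m)) / S.Q21 n := by
  have hm := S.measurableSet_surv n
  have hexp : ∀ k l : ℕ, Real.exp (-c * (k : ℝ) - d * (l : ℝ))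
      = Real.exp (-c) ^ k * Real.exp (-d) ^ l := fun k l => by
    rw [← Real.exp_nat_mul, ← Real.exp_nat_mul, ← Real.exp_add]
    congr 1
    ring
  have hc1 : Real.exp (-c) ≤ 1 := Real.exp_le_one_iff.2 (by linarith)
  have hd1 : Real.exp (-d) ≤ 1 := Real.exp_le_one_iff.2 (by linarith)
  have hpow : Integrable (fun ω => Real.exp (-c) ^ S.R1 m n ω * Real.exp (-d) ^ S.R2 m n ω) S.P2 :=
    integrable_pow_mul_pow (S.mR1 m n) (S.mR2 m n) (Real.exp_nonneg _) hc1 (Real.exp_nonneg _) hd1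
  have h1 := integral_add_compl hm hpow
  have h2 : ∫ ω in (S.surv n)ᶜ, Real.exp (-c) ^ S.R1 m n ω * Real.exp (-d) ^ S.R2 m n ω ∂S.P2
      = ∫ ω in (S.surv n)ᶜ, 1 ∂S.P2 := by
    refine setIntegral_congr_ae hm.compl ((S.hext m n).mono fun ω hω hs => ?_)
    have h3 : S.Z1 n ω = 0 ∧ S.Z2 n ω = 0 := by
      simpa [surv] using hs
    simp [hω h3]
  have h4 : ∫ ω in (S.surv n)ᶜ, (1 : ℝ) ∂S.P2 = 1 - S.Q21 n := by
    rw [setIntegral_const, measureReal_compl hm]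
    simp [Measure.real, Q21]
  have h5 := S.hreduced m n hmn (Real.exp (-c)) (Real.exp (-d)) (Real.exp_nonneg _) hc1
    (Real.exp_nonneg _) hd1
  change _ = S.F21 m (1 - (1 - Real.exp (-c)) * S.Q1 (n - m))
    (1 - (1 - Real.exp (-d)) * S.Q21 (n - m)) at h5
  rw [h2, h4, h5] at h1
  simp only [Ered, hexp]
  rw [eq_sub_iff_add_eq, ← add_div, div_eq_one_iff_eq hQ, Q21s]
  linarith

end GWSetup

lemma CriticalFun.tendsto_sq_ratio {f : ℝ → ℝ} {α : ℝ} {ι : Type*} {l : Filter ι}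
    (hf : CriticalFun f α) {x z : ι → ℝ} {y : ℝ} (hy : 0 < y)
    (hz : Tendsto z l (𝓝[>] 0)) (hxz : Tendsto (fun i => x i / z i) l (𝓝 y)) :
    Tendsto (fun i => x i ^ 2 / f (x i) / (z i ^ 2 / f (z i))) l (𝓝 (y ^ (1 - α))) := by
  have h := (hxz.pow 2).div (hf.tendsto_ratio hy hz hxz) (Real.rpow_pos_of_pos hy _).ne'
  have h1 : y ^ 2 / y ^ (1 + α) = y ^ (1 - α) := by
    rw [Real.rpow_add hy, Real.rpow_one, Real.rpow_sub hy, Real.rpow_one]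
    field_simp
  rw [h1] at h
  refine h.congr fun i => ?_
  simp only [Pi.div_apply]
  rw [div_div_div_comm, div_pow]

lemma exists_diagonal {p : ℕ → ℕ → Prop} (h : ∀ K, ∀ᶠ n in atTop, p K n) :
    ∃ K : ℕ → ℕ, Tendsto K atTop atTop ∧ ∀ᶠ n in atTop, p (K n) n := by
  classical
  choose N hN using fun K => eventually_atTop.1 (h K)
  refine ⟨fun n => Nat.findGreatest (fun K => N K ≤ n) n, tendsto_atTop.2 fun j => ?_, ?_⟩
  · filter_upwards [eventually_ge_atTop j, eventually_ge_atTop (N j)] with n h1 h2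
    exact Nat.le_findGreatest h1 h2
  · filter_upwards [eventually_ge_atTop (N 0)] with n hn
    exact hN _ n (Nat.findGreatest_spec (P := fun K => N K ≤ n) (Nat.zero_le n) hn)

namespace GWSetup

open CriticalFun

variable {S : GWSetup} {x1 x2 : ℝ}

lemma Q21s_mem (h1 : 0 ≤ x1) (h1' : x1 ≤ 1) (h2 : 0 ≤ x2) (h2' : x2 ≤ 1) (n : ℕ) :
    0 ≤ S.Q21s n (1 - x1) (1 - x2) ∧ S.Q21s n (1 - x1) (1 - x2) ≤ 1 := by
  have := S.F21_mem n (s1 := 1 - x1) (s2 := 1 - x2) (by linarith) (by linarith) (by linarith)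
    (by linarith)
  exact ⟨by rw [Q21s]; linarith, by rw [Q21s]; linarith⟩

lemma Q21s_zero : S.Q21s 0 (1 - x1) (1 - x2) = x2 := by
  rw [Q21s, F21_zero]; ring

lemma Q21s_succ (h1 : 0 ≤ x1) (h1' : x1 ≤ 1) (h2 : 0 ≤ x2) (h2' : x2 ≤ 1) (n : ℕ) :
    S.Q21s (n + 1) (1 - x1) (1 - x2)
      = 1 - S.F21 1 (1 - iter S.f1 n x1) (1 - S.Q21s n (1 - x1) (1 - x2)) := by
  rw [Q21s, S.F21_succ n (by linarith) (by linarith) (by linarith) (by linarith),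
    S.F1_eq n h1 h1', Q21s, sub_sub_cancel]

lemma Q21s_succ_le (h1 : 0 ≤ x1) (h1' : x1 ≤ 1) (h2 : 0 ≤ x2) (h2' : x2 ≤ 1) (n : ℕ) :
    S.Q21s (n + 1) (1 - x1) (1 - x2) ≤ S.Q21s n (1 - x1) (1 - x2)
      - S.f2 (S.Q21s n (1 - x1) (1 - x2)) + S.A21 * iter S.f1 n x1 := by
  rw [Q21s_succ h1 h1' h2 h2']
  have hq := S.criticalFun_f1.iter_mem_Icc h1 h1' n
  have hu := Q21s_mem (S := S) h1 h1' h2 h2' n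
  exact S.one_sub_F21_le hq.1 (hq.2.trans h1') hu.1 hu.2

lemma iter_le_Q21s (h1 : 0 ≤ x1) (h1' : x1 ≤ 1) (h2 : 0 ≤ x2) (h2' : x2 ≤ 1) (n : ℕ) :
    iter S.f2 n x2 ≤ S.Q21s n (1 - x1) (1 - x2) := by
  induction n with
  | zero => rw [Q21s_zero, iter_zero]
  | succ n ih =>
    have hq := S.criticalFun_f1.iter_mem_Icc h1 h1' n
    have hu := Q21s_mem (S := S) h1 h1' h2 h2' n
    have hi := S.criticalFun_f2.iter_mem_Icc h2 h2' n
    rw [Q21s_succ h1 h1' h2 h2', iter_succ]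
    refine le_trans ?_ (S.le_one_sub_F21 hq.1 (hq.2.trans h1') hu.1 hu.2)
    exact S.criticalFun_f2.sub_mono ⟨hi.1, hi.2.trans h2'⟩ hu ih

lemma Q21s_le_sum (h1 : 0 ≤ x1) (h1' : x1 ≤ 1) (h2 : 0 ≤ x2) (h2' : x2 ≤ 1) (n : ℕ) :
    S.Q21s n (1 - x1) (1 - x2) ≤ x2 + S.A21 * ∑ k ∈ Finset.range n, iter S.f1 k x1 := by
  induction n with
  | zero => simp [Q21s_zero]
  | succ n ih =>
    have h3 := Q21s_succ_le (S := S) h1 h1' h2 h2' n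
    have hu := Q21s_mem (S := S) h1 h1' h2 h2' n
    have h4 := S.criticalFun_f2.nonneg hu.1 hu.2
    rw [Finset.sum_range_succ]
    linarith

lemma Q21s_add_le (h1 : 0 ≤ x1) (h1' : x1 ≤ 1) (h2 : 0 ≤ x2) (h2' : x2 ≤ 1) (M j : ℕ) :
    S.Q21s (M + j) (1 - x1) (1 - x2) ≤ iter S.f2 j (S.Q21s M (1 - x1) (1 - x2))
      + S.A21 * (j * iter S.f1 M 1) := by
  have hA := S.hA21
  have hM := S.criticalFun_f1.iter_pos one_pos le_rfl M
  induction j with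
  | zero => simp [iter_zero]
  | succ j ih =>
    have h3 := Q21s_succ_le (S := S) h1 h1' h2 h2' (M + j)
    have hu := Q21s_mem (S := S) h1 h1' h2 h2' (M + j)
    have hu' := Q21s_mem (S := S) h1 h1' h2 h2' M
    have hi := S.criticalFun_f2.iter_mem_Icc hu'.1 hu'.2 j
    have h4 := S.criticalFun_f2.step_le hi.1 (hi.2.trans hu'.2) hu.1 hu.2 (by positivity) ih
    have h5 : iter S.f1 (M + j) x1 ≤ iter S.f1 M 1 :=
      (S.criticalFun_f1.iter_mono h1 h1' le_rfl _).trans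
        (S.criticalFun_f1.iter_anti zero_le_one le_rfl (Nat.le_add_right M j))
    rw [iter_succ, ← add_assoc]
    push_cast
    have h6 := mul_le_mul_of_nonneg_left h5 hA.le
    linarith

/-- Lower bound for `Q₂₁(n; ·, ·)` through the iterates of the one-type process. -/
lemma exists_le_Q21s {ε : ℝ} (hε : 0 < ε) (hεA : ε ≤ S.A21) : ∃ δ : ℝ, 0 < δ ∧
    ∀ (x1 x2 : ℝ) (n : ℕ), 0 ≤ x1 → x1 ≤ δ → 0 < x2 →
      x2 + S.A21 * ∑ k ∈ Finset.range n, iter S.f1 k x1 ≤ δ →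
      iter S.f2 n (x2 + (S.A21 - ε) * ∑ k ∈ Finset.range n, iter S.f1 k x1)
        ≤ S.Q21s n (1 - x1) (1 - x2) := by
  obtain ⟨δ, hδ, hρ⟩ := S.hρ ε hε
  refine ⟨min 1 (δ / 3), by positivity, fun x1 x2 n h1 h1' h2 hsum => ?_⟩
  have hA := S.hA21
  have hδ1 : min 1 (δ / 3) ≤ 1 := min_le_left _ _
  have hδ2 : min 1 (δ / 3) ≤ δ / 3 := min_le_right _ _
  have hx1 : x1 ≤ 1 := h1'.trans hδ1
  have hq := fun k => S.criticalFun_f1.iter_mem_Icc h1 hx1 k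
  have hs0 : ∀ k, 0 ≤ ∑ i ∈ Finset.range k, iter S.f1 i x1 := fun k =>
    Finset.sum_nonneg fun i _ => (hq i).1
  induction n with
  | zero => simp [Q21s_zero, iter_zero]
  | succ n ih =>
    set s := ∑ i ∈ Finset.range n, iter S.f1 i x1 with hs
    have hsn : 0 ≤ s := hs0 n
    rw [Finset.sum_range_succ, ← hs] at hsum ⊢
    have hqn := hq n
    have hAq : 0 ≤ S.A21 * iter S.f1 n x1 := mul_nonneg hA.le hqn.1
    have hAs : 0 ≤ S.A21 * s := mul_nonneg hA.le hsn
    have hsum' : x2 + S.A21 * s ≤ min 1 (δ / 3) := by linarith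
    have hx2 : x2 ≤ 1 := by linarith
    have ih := ih hsum'
    set u := S.Q21s n (1 - x1) (1 - x2) with hu
    have hu1 : u ≤ x2 + S.A21 * s := Q21s_le_sum h1 hx1 h2.le hx2 n
    have hu0 : 0 < u :=
      (S.criticalFun_f2.iter_pos h2 hx2 n).trans_le (iter_le_Q21s h1 hx1 h2.le hx2 n)
    have hu2 : u ≤ 1 := (Q21s_mem h1 hx1 h2.le hx2 n).2
    have hρ' := (abs_lt.1 (hρ (1 - iter S.f1 n x1) (1 - u) (by linarith) (by linarith)
      (by linarith) (by linarith) (by nlinarith [mul_nonneg hqn.1 hu0.le]))).2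
    rw [Q21s_succ h1 hx1 h2.le hx2, ← hu, S.one_sub_F21_eq hqn.1 (hqn.2.trans hx1) hu0 hu2]
    have hAε : 0 ≤ S.A21 - ε := sub_nonneg.2 hεA
    have h3 : 0 ≤ (S.A21 - ε) * s := mul_nonneg hAε hsn
    have h3' : 0 ≤ (S.A21 - ε) * iter S.f1 n x1 := mul_nonneg hAε hqn.1
    have h3'' : (S.A21 - ε) * (s + iter S.f1 n x1) ≤ S.A21 * (s + iter S.f1 n x1) := by
      gcongr
      · linarith [hqn.1]
      · linarith
    have hle1 : x2 + (S.A21 - ε) * (s + iter S.f1 n x1) ≤ 1 := by linarith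
    have hle2 : x2 + (S.A21 - ε) * s ≤ 1 := by linarith
    have h4 := S.criticalFun_f2.iter_le_add (a := x2 + (S.A21 - ε) * s)
      (b := x2 + (S.A21 - ε) * (s + iter S.f1 n x1)) (c := (S.A21 - ε) * iter S.f1 n x1)
      (by linarith) hle2 (by linarith) hle1 h3' (by linarith) (n + 1)
    have hi := S.criticalFun_f2.iter_mem_Icc (x := x2 + (S.A21 - ε) * s) (by linarith) hle2 n
    have h5 : iter S.f2 (n + 1) (x2 + (S.A21 - ε) * s) ≤ u - S.f2 u := by
      rw [iter_succ]
      exact S.criticalFun_f2.sub_mono ⟨hi.1, hi.2.trans hle2⟩ ⟨hu0.le, hu2⟩ ih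
    have h6 : (S.A21 - ε) * iter S.f1 n x1
        ≤ (S.A21 - S.ρ (1 - iter S.f1 n x1) (1 - u)) * iter S.f1 n x1 := by
      gcongr
      exact hqn.1
    linarith

lemma Q1_pos (n : ℕ) : 0 < S.Q1 n := by
  rw [Q1_eq]; exact S.criticalFun_f1.iter_pos one_pos le_rfl n

lemma Q2_pos (n : ℕ) : 0 < S.Q2 n := by
  rw [Q2_eq]; exact S.criticalFun_f2.iter_pos one_pos le_rfl n

lemma Q1_le_one (n : ℕ) : S.Q1 n ≤ 1 := by
  rw [Q1_eq]; exact (S.criticalFun_f1.iter_mem_Icc zero_le_one le_rfl n).2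

lemma Q1_anti : Antitone S.Q1 := fun m n h => by
  rw [Q1_eq, Q1_eq]; exact S.criticalFun_f1.iter_anti zero_le_one le_rfl h

lemma tendsto_Q1 : Tendsto S.Q1 atTop (𝓝[>] 0) := by
  simpa only [← Q1_eq] using S.criticalFun_f1.tendsto_iter_zero'

lemma tendsto_Q2 : Tendsto S.Q2 atTop (𝓝[>] 0) := by
  simpa only [← Q2_eq] using S.criticalFun_f2.tendsto_iter_zero'

lemma Q2_le_Q21 (n : ℕ) : S.Q2 n ≤ S.Q21 n := by
  rw [Q2_eq, Q21_eq]
  exact iter_le_Q21s zero_le_one le_rfl zero_le_one le_rfl n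

lemma Q21_le_one (n : ℕ) : S.Q21 n ≤ 1 := by
  rw [Q21_eq]
  exact (Q21s_mem zero_le_one le_rfl zero_le_one le_rfl n).2

/-- Under Condition (A), `n Q₁(M) ≪ Q₂(n)` for some `M ≪ n`. -/
lemma CondA.exists_negligible (hA : S.CondA) : ∃ M : ℕ → ℕ,
    Tendsto (fun n : ℕ => (M n : ℝ) / n) atTop (𝓝 0) ∧
    Tendsto (fun n : ℕ => n * S.Q1 (M n) / S.Q2 n) atTop (𝓝 0) := by
  have h0 : ∀ K : ℕ, Tendsto (fun n : ℕ => n * S.Q1 ⌊(1 / ((K : ℝ) + 1)) * n⌋₊ / S.Q2 n) atTop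
      (𝓝 0) := fun K => by
    have hK : (0 : ℝ) < 1 / ((K : ℝ) + 1) := by positivity
    have h1 : Tendsto (fun n : ℕ => (⌊(1 / ((K : ℝ) + 1)) * n⌋₊ : ℝ) / n) atTop
        (𝓝 (1 / ((K : ℝ) + 1))) :=
      (tendsto_nat_floor_mul_div_atTop hK.le).comp tendsto_natCast_atTop_atTop
    have h2 : Tendsto (fun n : ℕ => ⌊(1 / ((K : ℝ) + 1)) * n⌋₊) atTop atTop :=
      tendsto_nat_floor_atTop.comp (tendsto_natCast_atTop_atTop.const_mul_atTop hK)
    have h3 := S.criticalFun_f2.tendsto_iter_one_div hK h1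
    have h4 := ((h1.inv₀ hK.ne').mul (hA.comp h2)).mul h3
    rw [mul_zero, zero_mul] at h4
    refine h4.congr' ?_
    filter_upwards [h2.eventually_gt_atTop 0, eventually_gt_atTop 0] with n hn hn'
    have h5 : ((⌊(1 / ((K : ℝ) + 1)) * n⌋₊ : ℕ) : ℝ) ≠ 0 := by exact_mod_cast hn.ne'
    have h6 : (n : ℝ) ≠ 0 := by exact_mod_cast hn'.ne'
    simp only [Function.comp_apply, ← Q2_eq]
    have h7 := (Q2_pos (S := S) n).ne'
    have h8 := (Q2_pos (S := S) ⌊(1 / ((K : ℝ) + 1)) * n⌋₊).ne'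
    generalize ⌊(1 / ((K : ℝ) + 1)) * n⌋₊ = k at *
    field_simp
  obtain ⟨K, hK, hp⟩ := exists_diagonal (p := fun K n =>
    n * S.Q1 ⌊(1 / ((K : ℝ) + 1)) * n⌋₊ / S.Q2 n ≤ 1 / ((K : ℝ) + 1))
    fun K => (h0 K).eventually (ge_mem_nhds (by positivity))
  have hK' : Tendsto (fun n => 1 / ((K n : ℝ) + 1)) atTop (𝓝 0) :=
    tendsto_one_div_add_atTop_nhds_zero_nat.comp hK
  refine ⟨fun n => ⌊(1 / ((K n : ℝ) + 1)) * n⌋₊, ?_, ?_⟩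
  · refine tendsto_of_tendsto_of_tendsto_of_le_of_le' tendsto_const_nhds hK'
      (Eventually.of_forall fun n => by positivity) ?_
    filter_upwards [eventually_gt_atTop 0] with n hn
    have h6 : (0 : ℝ) < n := by exact_mod_cast hn
    rw [div_le_iff₀ h6]
    exact Nat.floor_le (by positivity)
  · refine tendsto_of_tendsto_of_tendsto_of_le_of_le' tendsto_const_nhds hK'
      (Eventually.of_forall fun n => ?_) hp
    have := Q1_pos (S := S) ⌊(1 / ((K n : ℝ) + 1)) * n⌋₊
    have := Q2_pos (S := S) n
    positivity

lemma tendsto_sub_div {m M : ℕ → ℕ} {κ : ℝ} (hκ : 0 < κ)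
    (hm : Tendsto (fun n : ℕ => (m n : ℝ) / n) atTop (𝓝 κ))
    (hM : Tendsto (fun n : ℕ => (M n : ℝ) / n) atTop (𝓝 0)) :
    (∀ᶠ n in atTop, M n ≤ m n) ∧
      Tendsto (fun n : ℕ => ((m n - M n : ℕ) : ℝ) / n) atTop (𝓝 κ) := by
  have h1 : ∀ᶠ n in atTop, M n ≤ m n := by
    filter_upwards [hM.eventually_lt hm hκ, eventually_gt_atTop 0] with n h2 h3
    have h6 : (0 : ℝ) < n := by exact_mod_cast h3
    rw [div_lt_div_iff_of_pos_right h6] at h2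
    exact_mod_cast h2.le
  refine ⟨h1, ?_⟩
  have h2 := hm.sub hM
  rw [sub_zero] at h2
  refine h2.congr' (h1.mono fun n hn => ?_)
  beta_reduce
  rw [Nat.cast_sub hn]
  ring

lemma tendsto_natCast_div_self : Tendsto (fun n : ℕ => (n : ℝ) / n) atTop (𝓝 1) :=
  tendsto_const_nhds.congr' ((eventually_gt_atTop 0).mono fun n hn =>
    (div_self (by exact_mod_cast hn.ne')).symm)

lemma CondA.tendsto_Q21_div_Q2 (hA : S.CondA) :
    Tendsto (fun n => S.Q21 n / S.Q2 n) atTop (𝓝 1) := by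
  obtain ⟨M, hM, hneg⟩ := hA.exists_negligible
  obtain ⟨hMn, hsub⟩ := tendsto_sub_div one_pos tendsto_natCast_div_self hM
  have h1 := (S.criticalFun_f2.tendsto_iter_one_div one_pos hsub).add (hneg.const_mul S.A21)
  rw [Real.one_rpow, mul_zero, add_zero] at h1
  refine tendsto_of_tendsto_of_tendsto_of_le_of_le' tendsto_const_nhds h1
    (Eventually.of_forall fun n => ?_) (hMn.mono fun n hn => ?_)
  · rw [one_le_div (Q2_pos n)]; exact Q2_le_Q21 n
  · have h2 := Q21s_add_le (S := S) zero_le_one le_rfl zero_le_one le_rfl (M n) (n - M n)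
    rw [Nat.add_sub_cancel' hn, ← Q21_eq, ← Q21_eq, ← Q1_eq] at h2
    have h3 : iter S.f2 (n - M n) (S.Q21 (M n)) ≤ iter S.f2 (n - M n) 1 :=
      S.criticalFun_f2.iter_mono ((Q2_pos _).le.trans (Q2_le_Q21 _)) (Q21_le_one _) le_rfl _
    have hpos := Q2_pos (S := S) n
    have hA21 := S.hA21
    have h4 : ((n - M n : ℕ) : ℝ) * S.Q1 (M n) ≤ n * S.Q1 (M n) := by
      gcongr
      · exact (Q1_pos _).le
      · exact Nat.sub_le _ _
    rw [← S.Q2_eq n, ← mul_div_assoc, ← add_div]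
    gcongr
    exact h2.trans (add_le_add h3 (by gcongr))

lemma tendsto_time_Q1 {k : ℕ → ℕ} (hk : Tendsto k atTop atTop) :
    Tendsto (fun n => S.Q1 (k n) / S.f1 (S.Q1 (k n)) / k n) atTop (𝓝 S.α1) := by
  simpa only [← Q1_eq, Function.comp_def] using S.criticalFun_f1.tendsto_time_one.comp hk

variable {hstar : ℕ → ℕ}

lemma IsHStar.α1_lt_one (hh : S.IsHStar hstar) : S.α1 < 1 := by
  refine lt_of_le_of_ne S.hα1.2 fun h => ?_
  simp [IsHStar, Asymp, h] at hh

lemma IsHStar.tendsto_sq (hh : S.IsHStar hstar) (hinf : Tendsto hstar atTop atTop) :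
    Tendsto (fun n => S.A21 * (S.Q1 (hstar n) ^ 2 / S.f1 (S.Q1 (hstar n))) / S.Q2 n) atTop
      (𝓝 (1 - S.α1)) := by
  have hα0 := S.hα1.1.ne'
  have hα1 : 1 - S.α1 ≠ 0 := (sub_pos.2 hh.α1_lt_one).ne'
  have h := (((tendsto_time_Q1 (S := S) hinf).div_const S.α1).mul hh).const_mul (1 - S.α1)
  rw [div_self hα0, mul_one, mul_one] at h
  refine h.congr' ?_
  filter_upwards [hinf.eventually_gt_atTop 0] with n hn
  have h6 : (hstar n : ℝ) ≠ 0 := by exact_mod_cast hn.ne'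
  have h7 := (S.criticalFun_f1.pos (Q1_pos (S := S) (hstar n)) (Q1_le_one _)).ne'
  have h8 := (Q2_pos (S := S) n).ne'
  generalize S.f1 (S.Q1 (hstar n)) = b at *
  field_simp

lemma IsHStar.eventually_le (hh : S.IsHStar hstar) (hinf : Tendsto hstar atTop atTop)
    (hA : S.CondA) : ∀ᶠ n in atTop, hstar n ≤ n := by
  have hα1 : 0 < 1 - S.α1 := sub_pos.2 hh.α1_lt_one
  have h1 := (S.criticalFun_f1.tendsto_sum_step.comp S.criticalFun_f1.tendsto_iter_zero').eventually
    (lt_mem_nhds hα1)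
  obtain ⟨N, hN⟩ := eventually_atTop.1 h1
  have h2 : ∀ k, N ≤ k → ∀ j, k ≤ j →
      S.Q1 j ^ 2 / S.f1 (S.Q1 j) ≤ S.Q1 k ^ 2 / S.f1 (S.Q1 k) := by
    intro k hk j hj
    induction j, hj using Nat.le_induction with
    | base => exact le_rfl
    | succ j hj ih =>
      refine le_trans ?_ ih
      have h3 := hN j (hk.trans hj)
      simp only [Function.comp_apply] at h3
      rw [← iter_succ, ← Q1_eq, ← Q1_eq, lt_div_iff₀ (Q1_pos j), zero_mul] at h3
      linarith
  have h3 : Tendsto (fun n => S.A21 * (S.Q1 n ^ 2 / S.f1 (S.Q1 n)) / S.Q2 n) atTop (𝓝 0) := by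
    have h4 := ((tendsto_time_Q1 (S := S) tendsto_id).mul hA).const_mul S.A21
    rw [mul_zero, mul_zero] at h4
    refine h4.congr' ?_
    filter_upwards [eventually_gt_atTop 0] with n hn
    have h6 : (n : ℝ) ≠ 0 := by exact_mod_cast hn.ne'
    have h7 := (S.criticalFun_f1.pos (Q1_pos (S := S) n) (Q1_le_one _)).ne'
    simp only [id]
    generalize S.f1 (S.Q1 n) = b at *
    field_simp
  filter_upwards [h3.eventually_lt (hh.tendsto_sq hinf) hα1, eventually_ge_atTop N] with n h4 h5
  by_contra! h6
  have h7 := h2 n h5 _ h6.le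
  have h8 := Q2_pos (S := S) n
  rw [div_lt_div_iff_of_pos_right h8, mul_lt_mul_iff_right₀ S.hA21] at h4
  linarith

/-- The total type-1 contribution is asymptotic to `l₁^{1-α₁} Q₂(n) / A₂₁`. -/
lemma IsHStar.tendsto_sum (hh : S.IsHStar hstar) (hinf : Tendsto hstar atTop atTop)
    (hA : S.CondA) {l1 : ℝ} (hl1 : 0 < l1) {x : ℕ → ℝ} {m : ℕ → ℕ}
    (hx : Tendsto x atTop (𝓝[>] 0))
    (hxl : Tendsto (fun n => x n / S.Q1 (hstar n)) atTop (𝓝 l1))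
    (hm : Tendsto (fun n : ℕ => (m n : ℝ) / n) atTop (𝓝 1)) :
    Tendsto (fun n => S.A21 * (∑ k ∈ Finset.range (m n), iter S.f1 k (x n)) / S.Q2 n) atTop
      (𝓝 (l1 ^ (1 - S.α1))) := by
  have hf := S.criticalFun_f1
  have hA21 := S.hA21
  have hα0 := S.hα1.1
  have hα1 : 0 < 1 - S.α1 := sub_pos.2 hh.α1_lt_one
  obtain ⟨M, hM, hneg⟩ := hA.exists_negligible
  obtain ⟨hMm, -⟩ := tendsto_sub_div one_pos hm hM
  have hz : Tendsto (fun n => S.Q1 (hstar n)) atTop (𝓝[>] 0) := tendsto_Q1.comp hinf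
  have hxpos := hx.eventually (Ioc_mem_nhdsGT one_pos)
  have h1 : Tendsto (fun n => S.A21 * (x n ^ 2 / S.f1 (x n)) / S.Q2 n) atTop
      (𝓝 (l1 ^ (1 - S.α1) * (1 - S.α1))) := by
    refine ((hf.tendsto_sq_ratio hl1 hz hxl).mul (hh.tendsto_sq hinf)).congr fun n => ?_
    have h7 := (hf.pos (Q1_pos (S := S) (hstar n)) (Q1_le_one _)).ne'
    have h8 := (Q1_pos (S := S) (hstar n)).ne'
    generalize S.f1 (S.Q1 (hstar n)) = b at *
    generalize S.f1 (x n) = c at *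
    field_simp
  have h2 : Tendsto (fun n => x n / S.f1 (x n) / hstar n) atTop (𝓝 (l1 ^ (-S.α1) * S.α1)) := by
    refine ((hf.tendsto_time_ratio hl1 hz hxl).mul (tendsto_time_Q1 (S := S) hinf)).congr fun n => ?_
    have h7 := (hf.pos (Q1_pos (S := S) (hstar n)) (Q1_le_one _)).ne'
    have h8 := (Q1_pos (S := S) (hstar n)).ne'
    generalize S.f1 (S.Q1 (hstar n)) = b at *
    generalize S.f1 (x n) = c at *
    field_simp
  have h3 : Tendsto (fun n => S.A21 * (iter S.f1 (m n) (x n) ^ 2 / S.f1 (iter S.f1 (m n) (x n)))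
      / S.Q2 n) atTop (𝓝 0) := by
    set C := l1 ^ (-S.α1) * S.α1 + 1
    have hC := hneg.const_mul (S.A21 * (C + 2 * (S.α1 + 1)))
    rw [mul_zero] at hC
    obtain ⟨δ, hδ0, hδ1, hδ⟩ := hf.time_iter one_pos
    refine tendsto_of_tendsto_of_tendsto_of_le_of_le' tendsto_const_nhds hC ?_ ?_
    · filter_upwards [hxpos] with n hn
      have h4 := hf.iter_mem_Icc hn.1.le hn.2 (m n)
      have h5 := hf.nonneg h4.1 (h4.2.trans hn.2)
      have h6 := Q2_pos (S := S) n
      positivity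
    · filter_upwards [hxpos, hx.eventually (Ioc_mem_nhdsGT hδ0), hMm,
        h2.eventually (gt_mem_nhds (lt_add_one _)), hh.eventually_le hinf hA,
        hinf.eventually_gt_atTop 0, hm.eventually (gt_mem_nhds one_lt_two), eventually_gt_atTop 0]
        with n hn hnδ hMn h4 h5 h6 h7 h8
      have h8' : (0 : ℝ) < n := by exact_mod_cast h8
      have h6' : (0 : ℝ) < hstar n := by exact_mod_cast h6
      have h5' : (hstar n : ℝ) ≤ n := by exact_mod_cast h5
      rw [div_lt_iff₀ h6'] at h4
      rw [div_lt_iff₀ h8'] at h7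
      have h9 := (abs_le.1 (hδ (x n) hnδ.1 hnδ.2 (m n))).2
      have hy0 := hf.iter_pos hn.1 hn.2 (m n)
      have hyM : iter S.f1 (m n) (x n) ≤ S.Q1 (M n) := by
        refine (hf.iter_mono hn.1.le hn.2 le_rfl _).trans ?_
        rw [← Q1_eq]
        exact Q1_anti hMn
      set y := iter S.f1 (m n) (x n)
      have hC0 : 0 < C := by positivity
      have h10 : y / S.f1 y ≤ (C + 2 * (S.α1 + 1)) * n := by
        have : C * hstar n ≤ C * n := by gcongr
        have : (S.α1 + 1) * m n ≤ (S.α1 + 1) * (2 * n) := by gcongr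
        linarith
      have h11 := Q2_pos (S := S) n
      have h12 := (Q1_pos (S := S) (M n)).le
      calc S.A21 * (y ^ 2 / S.f1 y) / S.Q2 n = S.A21 * (y * (y / S.f1 y)) / S.Q2 n := by ring
        _ ≤ S.A21 * (S.Q1 (M n) * ((C + 2 * (S.α1 + 1)) * n)) / S.Q2 n := by
          gcongr
          exact (hf.time_pos hy0 (hyM.trans (Q1_le_one _))).le
        _ = _ := by ring
  have hmpos : ∀ᶠ n in atTop, 0 < m n := by
    filter_upwards [hm.eventually (lt_mem_nhds one_pos)] with n hn
    by_contra! h0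
    simp [Nat.le_zero.1 h0] at hn
  have h4 := hf.tendsto_sum_iter hx hmpos
  have h5 := (h1.sub h3).div h4 hα1.ne'
  rw [sub_zero, mul_div_cancel_right₀ _ hα1.ne'] at h5
  refine h5.congr' ?_
  filter_upwards [h4.eventually (lt_mem_nhds hα1), hxpos] with n h6 h7
  have h8 := (Q2_pos (S := S) n).ne'
  simp only [Pi.div_apply]
  rw [← sub_div, ← mul_sub]
  set w := x n ^ 2 / S.f1 (x n) - iter S.f1 (m n) (x n) ^ 2 / S.f1 (iter S.f1 (m n) (x n))
  have hw : w ≠ 0 := fun h => by simp [h] at h6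
  have hT : ∑ k ∈ Finset.range (m n), iter S.f1 k (x n) ≠ 0 := fun h => by simp [h] at h6
  field_simp

/-- The limit of `Q₂₁(m; ·, ·) / Q₂(n)` for arguments on the scale of `Q₁(h*(n))` and `Q₂(n)`. -/
lemma IsHStar.tendsto_Q21s (hh : S.IsHStar hstar) (hinf : Tendsto hstar atTop atTop)
    (hA : S.CondA) {l1 l2 : ℝ} (hl1 : 0 < l1) (hl2 : 0 < l2) {x1 x2 : ℕ → ℝ} {m : ℕ → ℕ}
    (hx1 : Tendsto (fun n => x1 n / S.Q1 (hstar n)) atTop (𝓝 l1))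
    (hx2 : Tendsto (fun n => x2 n / S.Q2 n) atTop (𝓝 l2))
    (hm : Tendsto (fun n : ℕ => (m n : ℝ) / n) atTop (𝓝 1)) :
    Tendsto (fun n => S.Q21s (m n) (1 - x1 n) (1 - x2 n) / S.Q2 n) atTop
      (𝓝 ((1 + (l1 ^ (1 - S.α1) + l2) ^ (-S.α2)) ^ (-1 / S.α2))) := by
  have hA21 := S.hA21
  have hf := S.criticalFun_f2
  have hsmall : ∀ {x z : ℕ → ℝ} {c : ℝ}, 0 < c → Tendsto z atTop (𝓝[>] 0) →
      Tendsto (fun n => x n / z n) atTop (𝓝 c) → Tendsto x atTop (𝓝[>] 0) := by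
    intro x z c hc hz hxz
    have hz0 : ∀ᶠ n in atTop, 0 < z n := hz.eventually self_mem_nhdsWithin
    refine tendsto_nhdsWithin_iff.2 ⟨?_, ?_⟩
    · have := hxz.mul (tendsto_nhds_of_tendsto_nhdsWithin hz)
      rw [mul_zero] at this
      exact this.congr' (hz0.mono fun n hn => div_mul_cancel₀ _ hn.ne')
    · filter_upwards [hz0, hxz.eventually (lt_mem_nhds hc)] with n h1 h2
      rwa [lt_div_iff₀ h1, zero_mul] at h2
  have hx1' : Tendsto x1 atTop (𝓝[>] 0) := hsmall hl1 (tendsto_Q1.comp hinf) hx1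
  have hx2' : Tendsto x2 atTop (𝓝[>] 0) := hsmall hl2 tendsto_Q2 hx2
  have hp1 := hx1'.eventually (Ioc_mem_nhdsGT one_pos)
  have hp2 := hx2'.eventually (Ioc_mem_nhdsGT one_pos)
  set T : ℕ → ℝ := fun n => ∑ k ∈ Finset.range (m n), iter S.f1 k (x1 n) with hT
  have hsum : Tendsto (fun n => S.A21 * T n / S.Q2 n) atTop (𝓝 (l1 ^ (1 - S.α1))) :=
    hh.tendsto_sum hinf hA hl1 hx1' hx1 hm
  have hl : 0 < l1 ^ (1 - S.α1) + l2 := add_pos (Real.rpow_pos_of_pos hl1 _) hl2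
  have hy : Tendsto (fun n => (x2 n + S.A21 * T n) / S.Q2 n) atTop
      (𝓝 (l1 ^ (1 - S.α1) + l2)) := by
    have := hsum.add hx2
    exact this.congr fun n => by ring
  have hy0 : Tendsto (fun n => x2 n + S.A21 * T n) atTop (𝓝 0) :=
    tendsto_nhds_of_tendsto_nhdsWithin (hsmall hl tendsto_Q2 hy)
  have hT0 : ∀ᶠ n in atTop, 0 ≤ T n := by
    filter_upwards [hp1] with n hn
    exact Finset.sum_nonneg fun k _ => (S.criticalFun_f1.iter_mem_Icc hn.1.le hn.2 k).1
  obtain ⟨K, hK, hlow⟩ := exists_diagonal (p := fun K n =>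
    iter S.f2 (m n) (x2 n + (S.A21 - S.A21 * (1 / ((K : ℝ) + 1))) * T n)
      ≤ S.Q21s (m n) (1 - x1 n) (1 - x2 n)) fun K => by
    have hK1 : 1 / ((K : ℝ) + 1) ≤ 1 := by
      rw [div_le_one (by positivity)]
      linarith [K.cast_nonneg (α := ℝ)]
    obtain ⟨δ, hδ0, hδ⟩ := exists_le_Q21s (S := S) (ε := S.A21 * (1 / ((K : ℝ) + 1)))
      (by positivity) (mul_le_of_le_one_right hA21.le hK1)
    filter_upwards [hx1'.eventually (Ioc_mem_nhdsGT hδ0), hp2, hy0.eventually (ge_mem_nhds hδ0)]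
      with n h1 h2 h3
    exact hδ _ _ _ h1.1.le h1.2 h2.1 h3
  have hK' : Tendsto (fun n => 1 / ((K n : ℝ) + 1)) atTop (𝓝 0) :=
    tendsto_one_div_add_atTop_nhds_zero_nat.comp hK
  have hylow : Tendsto (fun n => (x2 n + (S.A21 - S.A21 * (1 / ((K n : ℝ) + 1))) * T n) / S.Q2 n)
      atTop (𝓝 (l1 ^ (1 - S.α1) + l2)) := by
    have := hy.sub (hK'.mul hsum)
    rw [zero_mul, sub_zero] at this
    exact this.congr fun n => by ring
  obtain ⟨M, hM, hneg⟩ := hA.exists_negligible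
  obtain ⟨hMm, hsub⟩ := tendsto_sub_div one_pos hm hM
  simp only [Q2_eq] at hy hylow
  have h1 := hf.tendsto_iter_div hl hylow hm
  have h2 := (hf.tendsto_iter_div hl hy hsub).add (hneg.const_mul (S.A21 * 2))
  rw [mul_zero, add_zero] at h2
  simp only [← Q2_eq] at h1 h2
  refine tendsto_of_tendsto_of_tendsto_of_le_of_le' h1 h2 ?_ ?_
  · filter_upwards [hlow] with n hn
    have := Q2_pos (S := S) n
    gcongr
  · filter_upwards [hMm, hp1, hp2, hy0.eventually (ge_mem_nhds one_pos),
      hm.eventually (gt_mem_nhds one_lt_two), eventually_gt_atTop 0] with n h3 h4 h5 h6 h7 h8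
    have h8' : (0 : ℝ) < n := by exact_mod_cast h8
    rw [div_lt_iff₀ h8'] at h7
    have h9 := Q21s_add_le (S := S) h4.1.le h4.2 h5.1.le h5.2 (M n) (m n - M n)
    rw [Nat.add_sub_cancel' h3, ← Q1_eq] at h9
    have h10 : S.Q21s (M n) (1 - x1 n) (1 - x2 n) ≤ x2 n + S.A21 * T n := by
      refine (Q21s_le_sum h4.1.le h4.2 h5.1.le h5.2 (M n)).trans ?_
      gcongr
      exact Finset.sum_le_sum_of_subset_of_nonneg (Finset.range_subset_range.2 h3)
        fun k _ _ => (S.criticalFun_f1.iter_mem_Icc h4.1.le h4.2 k).1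
    have h11 := hf.iter_mono (Q21s_mem h4.1.le h4.2 h5.1.le h5.2 (M n)).1 h10 h6 (m n - M n)
    have hQ1 := (Q1_pos (S := S) (M n)).le
    have h12 : ((m n - M n : ℕ) : ℝ) ≤ 2 * n :=
      (Nat.cast_le.2 (Nat.sub_le _ _)).trans h7.le
    have h13 : S.A21 * (((m n - M n : ℕ) : ℝ) * S.Q1 (M n)) ≤ S.A21 * (2 * n * S.Q1 (M n)) := by
      gcongr
    have hpos := Q2_pos (S := S) n
    rw [← mul_div_assoc, ← add_div]
    gcongr
    linarith

lemma tendsto_one_sub_exp_mul_div {a b : ℕ → ℝ} {c : ℝ} (hb : ∀ n, 0 < b n) (ha : ∀ n, 0 < a n)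
    (hab : Tendsto (fun n => a n / b n) atTop (𝓝 0)) :
    Tendsto (fun n => (1 - Real.exp (-(c * a n / b n))) * b n / a n) atTop (𝓝 c) := by
  have hder : HasDerivAt (fun t : ℝ => 1 - Real.exp (-(c * t))) c 0 := by
    have h1 : HasDerivAt (fun t : ℝ => -(c * t)) (-(c * 1)) 0 :=
      ((hasDerivAt_id (0 : ℝ)).const_mul c).neg
    simpa using h1.exp.const_sub 1
  have h2 := hasDerivAt_iff_tendsto_slope_zero.1 hder
  have h3 : Tendsto (fun n => a n / b n) atTop (𝓝[≠] 0) :=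
    tendsto_nhdsWithin_iff.2 ⟨hab, Eventually.of_forall fun n => (div_pos (ha n) (hb n)).ne'⟩
  refine (h2.comp h3).congr fun n => ?_
  have := (ha n).ne'
  have := (hb n).ne'
  simp only [Function.comp_apply, zero_add, mul_zero, neg_zero, Real.exp_zero, sub_self, sub_zero,
    smul_eq_mul, inv_div, mul_div_assoc]
  ring

end GWSetup

/-- Theorem `T_ZubQ1`(4).  Under Condition (A), with `h*` as
in (2.1) and `1 ≪ h(n) ≪ h*(n)`, `m = n - h(n)`, for `λ₁, λ₂ > 0`,
`E[exp(-λ₁ (Q₁(h*(n))/Q₁(h(n))) Z₁(m,n) - λ₂ (Q₂(n)/Q₂₁(h(n))) Z₂(m,n))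
   | Z(n) ≠ 0, Z(0) = e₂] → 1 - (1 + (λ₁^{1-α₁} + λ₂)^{-α₂})^{-1/α₂}`. -/
theorem condA_small_scale_reduced_pgf (S : GWSetup) (hA : S.CondA)
    (hstar : ℕ → ℕ) (hhstar : S.IsHStar hstar)
    (h : ℕ → ℕ)
    (hinf : Filter.Tendsto (fun n : ℕ => (h n : ℝ)) Filter.atTop Filter.atTop)
    (hup : Filter.Tendsto (fun n : ℕ => (h n : ℝ) / (hstar n : ℝ)) Filter.atTop (nhds 0))
    (l1 l2 : ℝ) (hl1 : 0 < l1) (hl2 : 0 < l2) :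
    Filter.Tendsto
      (fun n : ℕ => S.Ered (n - h n) n
        (fun k l => Real.exp (-(l1 * S.Q1 (hstar n) / S.Q1 (h n)) * (k : ℝ)
          - (l2 * S.Q2 n / S.Q21 (h n)) * (l : ℝ))))
      Filter.atTop
      (nhds (1 - (1 + (l1 ^ (1 - S.α1) + l2) ^ (-S.α2)) ^ (-1 / S.α2))) := by
  have hh : Tendsto h atTop atTop := tendsto_natCast_atTop_iff.1 hinf
  have hstarpos : ∀ᶠ n in atTop, 0 < hstar n := by
    filter_upwards [hhstar.eventually (lt_mem_nhds one_pos)] with n hn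
    by_contra! h0
    simp [Nat.le_zero.1 h0] at hn
  have hstarinf : Tendsto hstar atTop atTop := by
    refine tendsto_natCast_atTop_iff.1 (tendsto_atTop_mono' _ ?_ hinf)
    filter_upwards [hstarpos, hup.eventually (gt_mem_nhds one_pos)] with n h1 h2
    have h1' : (0 : ℝ) < hstar n := by exact_mod_cast h1
    rw [div_lt_one h1'] at h2
    exact h2.le
  have hstarle := hhstar.eventually_le hstarinf hA
  have hhn : Tendsto (fun n : ℕ => (h n : ℝ) / n) atTop (𝓝 0) := by
    refine tendsto_of_tendsto_of_tendsto_of_le_of_le' tendsto_const_nhds hup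
      (Eventually.of_forall fun n => by positivity) ?_
    filter_upwards [hstarpos, hstarle] with n h1 h2
    gcongr
  obtain ⟨hhle, hm⟩ := GWSetup.tendsto_sub_div one_pos GWSetup.tendsto_natCast_div_self hhn
  have hQ21pos : ∀ n, 0 < S.Q21 n := fun n => (GWSetup.Q2_pos n).trans_le (GWSetup.Q2_le_Q21 n)
  have hr1 : Tendsto (fun n => S.Q1 (hstar n) / S.Q1 (h n)) atTop (𝓝 0) := by
    simpa only [← GWSetup.Q1_eq] using
      S.criticalFun_f1.tendsto_iter_one_div_zero hh hstarinf hup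
  have hr2 : Tendsto (fun n => S.Q2 n / S.Q21 (h n)) atTop (𝓝 0) := by
    have h1 : Tendsto (fun n => S.Q2 n / S.Q2 (h n)) atTop (𝓝 0) := by
      simpa only [← GWSetup.Q2_eq, id] using
        S.criticalFun_f2.tendsto_iter_one_div_zero hh tendsto_id hhn
    refine tendsto_of_tendsto_of_tendsto_of_le_of_le tendsto_const_nhds h1
      (fun n => (div_pos (GWSetup.Q2_pos n) (hQ21pos _)).le) fun n => ?_
    exact div_le_div_of_nonneg_left (GWSetup.Q2_pos n).le (GWSetup.Q2_pos _) (GWSetup.Q2_le_Q21 _)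
  have h1 := hhstar.tendsto_Q21s hstarinf hA hl1 hl2
    (GWSetup.tendsto_one_sub_exp_mul_div (fun n => GWSetup.Q1_pos (h n))
      (fun n => GWSetup.Q1_pos (hstar n)) hr1)
    (GWSetup.tendsto_one_sub_exp_mul_div (fun n => hQ21pos (h n)) GWSetup.Q2_pos hr2) hm
  have h2 := (h1.div hA.tendsto_Q21_div_Q2 one_ne_zero).const_sub 1
  rw [div_one] at h2
  refine h2.congr' ?_
  filter_upwards [hhle] with n hn
  have hq1 := GWSetup.Q1_pos (S := S) (hstar n)
  have hq2 := GWSetup.Q1_pos (S := S) (h n)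
  have hq3 := GWSetup.Q2_pos (S := S) n
  rw [S.Ered_eq (Nat.sub_le _ _) (hQ21pos n).ne' (by positivity)
    (div_pos (by positivity) (hQ21pos _)).le, Nat.sub_sub_self hn]
  simp only [Pi.div_apply]
  rw [div_div_div_cancel_right₀ hq3.ne']
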